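/- If the rotation set of f ∈ Homeo_{0,λ}(T²) is δ-upper-stable in Homeo_{0,λ}(T²) for some δ > 0, then for any lift f̃ every extremal point of ρ(f̃) has rational coordinates, and when such a point is written in reduced form (p₁/q, p₂/q) with p₁, p₂, q integers, q ≥ 1 and gcd(p₁, p₂, q) = 1, one has q ≤ 4/(πδ²). In particular ρ(f̃) has only finitely many extremal points and is the convex hull of a finite subset of ℚ². -/

import Mathlib

noncomputable section

open Metric Set Filter Topology MeasureTheory Pointwise

/-- The plane `ℝ²` with the Euclidean metric. -/
abbrev R2 : Type := EuclideanSpace ℝ (Fin 2)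

/-- The integer lattice `ℤ² ⊂ ℝ²`. -/
def intLattice : AddSubgroup R2 where
  carrier := {v : R2 | ∀ i, ∃ n : ℤ, v i = (n : ℝ)}
  add_mem' := by
    intro a b ha hb i
    obtain ⟨m, hm⟩ := ha i
    obtain ⟨n, hn⟩ := hb i
    exact ⟨m + n, by push_cast; rw [← hm, ← hn]; rfl⟩
  zero_mem' := fun i => ⟨0, by simp⟩
  neg_mem' := by
    intro a ha i
    obtain ⟨m, hm⟩ := ha i
    exact ⟨-m, by push_cast; rw [← hm]; rfl⟩

/-- The torus `T² = ℝ²/ℤ²`, with the quotient (Euclidean) metric. -/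
abbrev T2 : Type := R2 ⧸ intLattice

/-- The covering projection `π : ℝ² → T²`. -/
def pr : R2 → T2 := QuotientAddGroup.mk

instance : MeasurableSpace T2 := borel T2
instance : BorelSpace T2 := ⟨rfl⟩

/-- A fundamental domain `[0,1)²` for the lattice action. -/
def fundDomain : Set R2 := {x : R2 | ∀ i, x i ∈ Set.Ico (0 : ℝ) 1}

/-- Lebesgue (Haar) probability measure on the torus `T²`. -/
def lebT2 : Measure T2 := Measure.map pr (volume.restrict fundDomain)

/-- `F : ℝ² → ℝ²` is a lift of `f : T² → T²` if `π ∘ F = f ∘ π` and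
`F (x + w) = F x + w` for every lattice vector `w ∈ ℤ²`. -/
structure IsLift (f : T2 ≃ₜ T2) (F : R2 ≃ₜ R2) : Prop where
  proj : ∀ x : R2, pr (F x) = f (pr x)
  equivariant : ∀ x : R2, ∀ w ∈ intLattice, F (x + w) = F x + w

/-- `Homeo₀(T²)`: homeomorphisms of the torus isotopic to the identity,
characterized as those admitting a lift commuting with integer translations. -/
def Homeo0 : Set (T2 ≃ₜ T2) := {f | ∃ F : R2 ≃ₜ R2, IsLift f F}

/-- `Homeo_{0,λ}(T²)`: elements of `Homeo₀(T²)` preserving Lebesgue measure. -/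
def Homeo0Leb : Set (T2 ≃ₜ T2) :=
  {f | f ∈ Homeo0 ∧ MeasurePreserving f lebT2 lebT2}

/-- The uniform `C⁰` distance `d_{C⁰}(f,g) = sup_x d(f(x), g(x))` on torus maps. -/
def dC0 (f g : T2 ≃ₜ T2) : ℝ := ⨆ x : T2, dist (f x) (g x)

/-- The uniform distance `sup_{x ∈ ℝ²} ‖F(x) − G(x)‖` between maps of the plane. -/
def supDist (F G : R2 → R2) : ℝ := ⨆ x : R2, dist (F x) (G x)

/-- The rotation set `ρ(F̃)` of a lift: all limits `(F̃^{n_k}(z_k) − z_k)/n_k`. -/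
def rotSet (F : R2 ≃ₜ R2) : Set R2 :=
  {v | ∃ (z : ℕ → R2) (n : ℕ → ℕ), Tendsto n atTop atTop ∧
    Tendsto (fun k => (n k : ℝ)⁻¹ • ((⇑F)^[n k] (z k) - z k)) atTop (𝓝 v)}

/-- The rotation set of `f`, with fixed lift `F`, is `δ`-upper-stable in `H`. -/
def UpperStable (H : Set (T2 ≃ₜ T2)) (F : R2 ≃ₜ R2) (δ : ℝ) : Prop :=
  ∀ g ∈ H, ∀ G : R2 ≃ₜ R2, IsLift g G → supDist (⇑F) (⇑G) < δ →
    rotSet G ⊆ rotSet F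

/-- The rotation set of `f`, with fixed lift `F`, is `δ`-stable in `H`. -/
def StableRS (H : Set (T2 ≃ₜ T2)) (F : R2 ≃ₜ R2) (δ : ℝ) : Prop :=
  ∀ g ∈ H, ∀ G : R2 ≃ₜ R2, IsLift g G → supDist (⇑F) (⇑G) < δ →
    rotSet G = rotSet F

/-- `f` has a stable rotation set in `H`. -/
def HasStableRotSet (H : Set (T2 ≃ₜ T2)) (f : T2 ≃ₜ T2) : Prop :=
  ∃ F : R2 ≃ₜ R2, IsLift f F ∧ ∃ δ > 0, StableRS H F δ

/-- `S` is open in `H` for the uniform `C⁰` topology. -/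
def OpenIn (H S : Set (T2 ≃ₜ T2)) : Prop :=
  ∀ f ∈ S ∩ H, ∃ δ > 0, ∀ g ∈ H, dC0 f g < δ → g ∈ S

/-- `S` is dense in `H` for the uniform `C⁰` topology. -/
def DenseIn (H S : Set (T2 ≃ₜ T2)) : Prop :=
  ∀ f ∈ H, ∀ ε > 0, ∃ g ∈ S ∩ H, dC0 f g < ε

/-- `(x_i)_{0 ≤ i ≤ n}` is a finite `ε`-pseudo-orbit of `F`. -/
def IsPseudoOrbitUpTo (F : R2 → R2) (ε : ℝ) (x : ℕ → R2) (n : ℕ) : Prop :=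
  ∀ i < n, dist (F (x i)) (x (i + 1)) < ε

/-- `(x_i)_{i ∈ ℕ}` is an infinite `ε`-pseudo-orbit of `F`. -/
def IsPseudoOrbit (F : R2 → R2) (ε : ℝ) (x : ℕ → R2) : Prop :=
  ∀ i : ℕ, dist (F (x i)) (x (i + 1)) < ε

/-- The `ε`-pseudo-rotation set `ρ_ε(F̃)`. -/
def pseudoRotSet (F : R2 → R2) (ε : ℝ) : Set R2 :=
  {v | ∃ (n : ℕ → ℕ) (x : ℕ → ℕ → R2), Tendsto n atTop atTop ∧
    (∀ k, IsPseudoOrbitUpTo F ε (x k) (n k)) ∧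
    Tendsto (fun k => (n k : ℝ)⁻¹ • (x k (n k) - x k 0)) atTop (𝓝 v)}

/-- The oscillation `osc(f) = sup_{x,y} ‖(F(x) − x) − (F(y) − y)‖` of a lift. -/
def osc (F : R2 → R2) : ℝ := ⨆ p : R2 × R2, ‖(F p.1 - p.1) - (F p.2 - p.2)‖

/-- `f` has the shadowing property. -/
def Shadowing (f : T2 ≃ₜ T2) : Prop :=
  ∀ ε > 0, ∃ δ > 0, ∀ x : ℕ → T2, (∀ i, dist (f (x i)) (x (i + 1)) < δ) →
    ∃ z : T2, ∀ i, dist ((⇑f)^[i] z) (x i) < ε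

/-- `v ∈ ℚ² ⊂ ℝ²`. -/
def IsRationalPoint (v : R2) : Prop := ∀ i, ∃ q : ℚ, v i = (q : ℝ)


lemma lat_norm_ge {l : R2} (hl : l ∈ intLattice) (h0 : l ≠ 0) : 1 ≤ ‖l‖ := by
  have : ∃ i, l i ≠ 0 := by
    by_contra! h
    exact h0 (by ext i; simpa using h i)
  obtain ⟨i, hi⟩ := this
  obtain ⟨n, hn⟩ := hl i
  have h1 : (1:ℝ) ≤ |l i| := by
    rw [hn] at hi ⊢
    have : n ≠ 0 := by rintro rfl; simp at hi
    have h2 : (1:ℤ) ≤ |n| := Int.one_le_abs this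
    rw [← Int.cast_abs]
    exact_mod_cast h2
  exact h1.trans (by simpa using PiLp.norm_apply_le l i)

lemma lat_eq_of_close {l m : R2} (hl : l ∈ intLattice) (hm : m ∈ intLattice)
    (h : ‖l - m‖ < 1) : l = m := by
  by_contra hne
  have := lat_norm_ge (intLattice.sub_mem hl hm) (sub_ne_zero.2 hne)
  linarith

instance : Countable intLattice := by
  let φ : intLattice → (Fin 2 → ℤ) := fun l i => (l.2 i).choose
  have : Function.Injective φ := by
    intro a b hab
    apply Subtype.ext
    ext i
    rw [(a.2 i).choose_spec, (b.2 i).choose_spec]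
    exact congrArg (fun n : ℤ => (n : ℝ)) (congrFun hab i)
  exact this.countable

lemma pr_eq_iff {x y : R2} : pr x = pr y ↔ y - x ∈ intLattice := by
  unfold pr
  rw [QuotientAddGroup.eq]
  rw [show -x + y = y - x by abel]

lemma pr_add_lat (x : R2) {w : R2} (hw : w ∈ intLattice) : pr (x + w) = pr x := by
  rw [eq_comm, pr_eq_iff]; simpa using hw

lemma pr_cont : Continuous pr := QuotientAddGroup.continuous_mk

lemma pr_open : IsOpenMap pr := QuotientAddGroup.isOpenMap_coe

lemma pr_surj : Function.Surjective pr := QuotientAddGroup.mk_surjective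

lemma pr_quot : IsQuotientMap pr := pr_open.isQuotientMap pr_cont pr_surj

def latVec (a b : ℤ) : R2 := !₂[(a:ℝ), (b:ℝ)]

lemma latVec_mem (a b : ℤ) : latVec a b ∈ intLattice := by
  intro i
  fin_cases i
  · exact ⟨a, rfl⟩
  · exact ⟨b, rfl⟩

lemma lat_exists {l : R2} (hl : l ∈ intLattice) : ∃ a b : ℤ, l = latVec a b := by
  obtain ⟨a, ha⟩ := hl 0
  obtain ⟨b, hb⟩ := hl 1
  refine ⟨a, b, ?_⟩
  ext i
  fin_cases i
  · exact ha
  · exact hb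

/-- translated fundamental domain -/
def fdom (u : R2) : Set R2 := {x : R2 | ∀ i, x i - u i ∈ Set.Ico (0 : ℝ) 1}

lemma fdom_zero : fdom 0 = fundDomain := by
  ext x; simp [fdom, fundDomain]

lemma fdom_meas (u : R2) : MeasurableSet (fdom u) := by
  have : fdom u = ⋂ i, (fun x : R2 => x i - u i) ⁻¹' Set.Ico (0 : ℝ) 1 := by
    ext x; simp [fdom]
  rw [this]
  refine MeasurableSet.iInter fun i => ?_
  have : Measurable (fun x : R2 => x i - u i) := by fun_prop
  exact this measurableSet_Ico

lemma fdom_fund (u : R2) : IsAddFundamentalDomain intLattice (fdom u) (volume : Measure R2) := by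
  refine IsAddFundamentalDomain.mk' (fdom_meas u).nullMeasurableSet fun x => ?_
  refine ⟨⟨latVec (-⌊x 0 - u 0⌋) (-⌊x 1 - u 1⌋), latVec_mem _ _⟩, ?_, ?_⟩
  · intro i
    simp only [AddSubgroup.mk_vadd, vadd_eq_add, PiLp.add_apply]
    fin_cases i
    · simp only [latVec]
      have h1 := Int.floor_le (x 0 - u 0)
      have h2 := Int.lt_floor_add_one (x 0 - u 0)
      simp
      constructor <;> linarith
    · simp only [latVec]
      have h1 := Int.floor_le (x 1 - u 1)
      have h2 := Int.lt_floor_add_one (x 1 - u 1)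
      simp
      constructor <;> linarith
  · rintro ⟨l, hl⟩ h
    obtain ⟨a, b, rfl⟩ := lat_exists hl
    have h0 := h 0
    have h1 := h 1
    simp [latVec, AddSubgroup.mk_vadd] at h0 h1
    have e0 : ⌊x 0 - u 0⌋ = -a := by
      rw [Int.floor_eq_iff]; push_cast; constructor <;> linarith [h0.1, h0.2]
    have e1 : ⌊x 1 - u 1⌋ = -b := by
      rw [Int.floor_eq_iff]; push_cast; constructor <;> linarith [h1.1, h1.2]
    simp [e0, e1]

lemma vol_fund : volume fundDomain = 1 := by
  have e : fundDomain = (MeasurableEquiv.toLp 2 (Fin 2 → ℝ)).symm ⁻¹'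
      (Set.univ.pi fun _ => Set.Ico (0:ℝ) 1) := by
    ext x
    simp only [fundDomain, mem_preimage, Set.mem_univ_pi]
    rfl
  rw [e, (EuclideanSpace.volume_preserving_symm_measurableEquiv_toLp (Fin 2)).measure_preimage_equiv]
  simp [Real.volume_pi_Ico]

lemma leb_apply {A : Set T2} (hA : MeasurableSet A) (u : R2) :
    lebT2 A = volume (pr ⁻¹' A ∩ fdom u) := by
  unfold lebT2
  have hm : Measurable pr := pr_cont.measurable
  rw [Measure.map_apply hm hA, Measure.restrict_apply (hm hA), ← fdom_zero]
  refine (fdom_fund 0).measure_set_eq (fdom_fund u) (hm hA) ?_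
  rintro ⟨g, hg⟩
  ext x
  simp only [mem_preimage, AddSubgroup.mk_vadd, vadd_eq_add]
  rw [add_comm, pr_add_lat x hg]

instance : IsProbabilityMeasure lebT2 := by
  constructor
  rw [leb_apply MeasurableSet.univ 0, fdom_zero]
  simp [vol_fund]

lemma leb_open_pos {U : Set T2} (hU : IsOpen U) (h : lebT2 U = 0) : U = ∅ := by
  rw [leb_apply hU.measurableSet 0] at h
  have h2 := (fdom_fund 0).measure_zero_of_invariant (pr ⁻¹' U) ?_ h
  · have h3 := ((hU.preimage pr_cont).measure_eq_zero_iff volume).1 h2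
    rw [eq_empty_iff_forall_notMem]
    intro y hy
    obtain ⟨x, rfl⟩ := pr_surj y
    have : x ∈ pr ⁻¹' U := hy
    simp [h3] at this
  · rintro ⟨g, hg⟩
    ext x
    rw [mem_vadd_set_iff_neg_vadd_mem]
    simp only [mem_preimage]
    have : -(⟨g, hg⟩ : intLattice) +ᵥ x = x + (-g) := by
      rw [add_comm]; rfl
    rw [this, pr_add_lat x (intLattice.neg_mem hg)]

/-- descend an equivariant homeomorphism -/
lemma descend (H : R2 ≃ₜ R2) (hH : ∀ x : R2, ∀ w ∈ intLattice, H (x + w) = H x + w) :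
    ∃ h : T2 ≃ₜ T2, IsLift h H := by
  have hS : ∀ x : R2, ∀ w ∈ intLattice, H.symm (x + w) = H.symm x + w := by
    intro x w hw
    apply H.injective
    rw [hH _ _ hw]; simp
  let down (G : R2 ≃ₜ R2) (hG : ∀ x : R2, ∀ w ∈ intLattice, G (x + w) = G x + w) : T2 → T2 :=
    Quotient.lift (fun x => pr (G x)) (by
      intro a b hab
      have h1 : b - a ∈ intLattice := by
        rw [← pr_eq_iff]; exact Quotient.sound hab
      show pr (G a) = pr (G b)
      rw [show b = a + (b - a) by abel, hG _ _ h1, pr_add_lat _ h1])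
  have hd : ∀ G hG x, down G hG (pr x) = pr (G x) := fun G hG x => rfl
  have hc : ∀ G hG, Continuous (down G hG) := by
    intro G hG
    rw [pr_quot.continuous_iff]
    exact pr_cont.comp G.continuous
  let h : T2 ≃ₜ T2 := ⟨⟨down H hH, down H.symm hS, ?_, ?_⟩, hc H hH, hc H.symm hS⟩
  · exact ⟨h, ⟨fun x => rfl, hH⟩⟩
  · intro y; obtain ⟨x, rfl⟩ := pr_surj y; rw [hd H hH, hd H.symm hS]; simp
  · intro y; obtain ⟨x, rfl⟩ := pr_surj y; rw [hd H.symm hS, hd H hH]; simp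

/-- area preserving pair -/
def Good (H : R2 ≃ₜ R2) : Prop := ∃ h : T2 ≃ₜ T2, IsLift h H ∧ MeasurePreserving h lebT2 lebT2

lemma Good.refl : Good (Homeomorph.refl R2) :=
  ⟨Homeomorph.refl T2, ⟨fun _ => rfl, fun _ _ _ => rfl⟩, MeasurePreserving.id _⟩

lemma Good.trans {H K : R2 ≃ₜ R2} (hH : Good H) (hK : Good K) : Good (H.trans K) := by
  obtain ⟨h, h1, h2⟩ := hH
  obtain ⟨k, k1, k2⟩ := hK
  refine ⟨h.trans k, ⟨fun x => ?_, fun x w hw => ?_⟩, k2.comp h2⟩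
  · simp [k1.proj, h1.proj]
  · simp [h1.equivariant x w hw, k1.equivariant _ w hw]

/-- planar twist in the complex plane -/
def ctw (θ : ℝ → ℝ) (z : ℂ) : ℂ := z * Complex.exp (θ ‖z‖ * Complex.I)

lemma ctw_norm (θ : ℝ → ℝ) (z : ℂ) : ‖ctw θ z‖ = ‖z‖ := by
  simp [ctw, Complex.norm_exp_ofReal_mul_I]

lemma ctw_inv (θ : ℝ → ℝ) (z : ℂ) : ctw (fun r => - θ r) (ctw θ z) = z := by
  have h := ctw_norm θ z
  unfold ctw at *
  rw [h, mul_assoc, ← Complex.exp_add]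
  simp

lemma ctw_cont {θ : ℝ → ℝ} (hθ : Continuous θ) : Continuous (ctw θ) := by
  unfold ctw; fun_prop

lemma lint_periodic (g : ℝ → ENNReal) (hg : ∀ x, g (x + 2 * Real.pi) = g x) (a : ℝ) :
    ∫⁻ x in Ioo (-Real.pi) Real.pi, g (x + a) = ∫⁻ x in Ioo (-Real.pi) Real.pi, g x := by
  have hpi : (0:ℝ) < 2 * Real.pi := by positivity
  have f1 := isAddFundamentalDomain_Ioc hpi (-Real.pi)
  have f2 := isAddFundamentalDomain_Ioc hpi (-Real.pi + a)
  have hz : ∀ (n : ℤ) (x : ℝ), g (n • (2 * Real.pi) + x) = g x := by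
    intro n x
    have : Function.Periodic g (2 * Real.pi) := hg
    rw [add_comm]
    exact this.zsmul n x
  have key := f2.setLIntegral_eq f1 g (by
    rintro ⟨_, n, rfl⟩ x
    exact hz n x)
  rw [show -Real.pi + 2 * Real.pi = Real.pi by ring,
    show -Real.pi + a + 2 * Real.pi = Real.pi + a by ring] at key
  rw [restrict_Ioo_eq_restrict_Ioc, ← key]
  have hmp := measurePreserving_add_right (volume : Measure ℝ) a
  have := hmp.setLIntegral_comp_preimage_emb (MeasurableEquiv.addRight a).measurableEmbedding g
    (Ioc (-Real.pi + a) (Real.pi + a))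
  rw [← this]
  simp

lemma ctw_mp {θ : ℝ → ℝ} (hθ : Continuous θ) : MeasurePreserving (ctw θ) volume volume := by
  have hm : Measurable (ctw θ) := (ctw_cont hθ).measurable
  refine ⟨hm, ?_⟩
  ext S hS
  rw [Measure.map_apply hm hS]
  have hS' := hm hS
  rw [← lintegral_indicator_one hS, ← lintegral_indicator_one hS']
  rw [← Complex.lintegral_comp_polarCoord_symm, ← Complex.lintegral_comp_polarCoord_symm]
  have key : ∀ (T : Set ℂ), MeasurableSet T →
      ∫⁻ p in polarCoord.target, ENNReal.ofReal p.1 • T.indicator 1 (Complex.polarCoord.symm p)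
      = ∫⁻ r in Ioi (0:ℝ), ENNReal.ofReal r * ∫⁻ φ in Ioo (-Real.pi) Real.pi,
          (T.indicator (1 : ℂ → ENNReal) (Complex.polarCoord.symm (r, φ))) := by
    intro T hT
    have hcont : Continuous (fun p : ℝ × ℝ => Complex.polarCoord.symm p) := by
      have : (fun p : ℝ × ℝ => Complex.polarCoord.symm p) =
        fun p : ℝ × ℝ => (p.1 * (Real.cos p.2 + Real.sin p.2 * Complex.I) : ℂ) := by
        ext p; rw [Complex.polarCoord_symm_apply]
      rw [this]; fun_prop
    have hmeas : Measurable (fun p : ℝ × ℝ => T.indicator (1 : ℂ → ENNReal)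
        (Complex.polarCoord.symm p)) :=
      (measurable_one.indicator hT).comp hcont.measurable
    rw [polarCoord_target, Measure.volume_eq_prod, ← Measure.prod_restrict, lintegral_prod]
    · refine lintegral_congr fun r => ?_
      simp only [smul_eq_mul]
      rw [lintegral_const_mul]
      exact hmeas.comp measurable_prodMk_left
    · refine Measurable.aemeasurable ?_
      simp only [smul_eq_mul]
      exact (ENNReal.measurable_ofReal.comp measurable_fst).mul hmeas
  rw [key _ hS, key _ hS']
  refine setLIntegral_congr_fun measurableSet_Ioi fun r hr => ?_
  have hr : 0 < r := hr
  congr 1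
  have e : ∀ r φ : ℝ, Complex.polarCoord.symm (r, φ) = r * Complex.exp (φ * Complex.I) := by
    intro r φ
    rw [Complex.polarCoord_symm_apply, Complex.exp_mul_I]
    simp
  have := lint_periodic (fun φ => S.indicator (1 : ℂ → ENNReal) (Complex.polarCoord.symm (r, φ)))
    (by
      intro x
      simp only [e]
      congr 2
      push_cast
      rw [add_mul, Complex.exp_add]
      simp) (θ r)
  rw [← this]
  refine lintegral_congr fun φ => ?_
  have e2 : ctw θ (Complex.polarCoord.symm (r, φ)) = Complex.polarCoord.symm (r, φ + θ r) := by
    rw [e, e, ctw]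
    have : ‖(r : ℂ) * Complex.exp (φ * Complex.I)‖ = r := by
      rw [norm_mul, Complex.norm_exp_ofReal_mul_I]
      simp [abs_of_pos hr]
    rw [this]
    push_cast
    rw [add_mul, Complex.exp_add]; ring
  rw [← e2]
  rfl

def eC : ℂ ≃ₗᵢ[ℝ] R2 := Complex.orthonormalBasisOneI.repr

/-- planar twist in the plane -/
def tw (θ : ℝ → ℝ) (y : R2) : R2 := eC (ctw θ (eC.symm y))

lemma tw_norm (θ : ℝ → ℝ) (y : R2) : ‖tw θ y‖ = ‖y‖ := by
  simp [tw, ctw_norm]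

lemma tw_inv (θ : ℝ → ℝ) (y : R2) : tw (fun r => - θ r) (tw θ y) = y := by
  simp [tw, ctw_inv]

lemma tw_cont {θ : ℝ → ℝ} (hθ : Continuous θ) : Continuous (tw θ) := by
  unfold tw
  exact eC.continuous.comp ((ctw_cont hθ).comp eC.symm.continuous)

lemma tw_mp {θ : ℝ → ℝ} (hθ : Continuous θ) :
    MeasurePreserving (tw θ) (volume : Measure R2) volume :=
  (eC.measurePreserving).comp ((ctw_mp hθ).comp (eC.symm.measurePreserving))

lemma tw_of_zero {θ : ℝ → ℝ} {y : R2} (h : θ ‖y‖ = 0) : tw θ y = y := by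
  simp [tw, ctw, h]

lemma tw_of_pi {θ : ℝ → ℝ} {y : R2} (h : θ ‖y‖ = Real.pi) : tw θ y = -y := by
  simp [tw, ctw, h]

lemma tw_disp (θ : ℝ → ℝ) (y : R2) : ‖tw θ y - y‖ = 2 * ‖y‖ * |Real.sin (θ ‖y‖ / 2)| := by
  have : tw θ y - y = eC (ctw θ (eC.symm y) - eC.symm y) := by simp [tw]
  rw [this, LinearIsometryEquiv.norm_map]
  simp only [ctw, LinearIsometryEquiv.norm_map]
  rw [← mul_sub_one, norm_mul, LinearIsometryEquiv.norm_map]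
  have h := Complex.norm_exp_I_mul_ofReal_sub_one (θ ‖y‖)
  rw [mul_comm] at h
  rw [h]
  simp; ring

/-- the angle function -/
def ang (r0 : ℝ) (r : ℝ) : ℝ := 2 * Real.arcsin (max 0 (min 1 (2 - r / r0)))

lemma ang_cont (r0 : ℝ) : Continuous (ang r0) := by
  unfold ang
  exact continuous_const.mul (Real.continuous_arcsin.comp (by fun_prop))

lemma ang_at {r0 : ℝ} (h : 0 < r0) : ang r0 r0 = Real.pi := by
  unfold ang
  rw [div_self h.ne']; norm_num
  ring

lemma ang_zero {r0 r : ℝ} (h : 0 < r0) (hr : 2 * r0 ≤ r) : ang r0 r = 0 := by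
  unfold ang
  have : 2 - r / r0 ≤ 0 := by
    rw [sub_nonpos, le_div_iff₀ h]; exact hr
  rw [max_eq_left]; · simp
  exact (min_le_right _ _).trans this

lemma ang_disp {r0 r : ℝ} (h : 0 < r0) (hr : 0 ≤ r) :
    2 * r * |Real.sin (ang r0 r / 2)| ≤ 2 * r0 := by
  unfold ang
  rw [mul_div_cancel_left₀ _ (two_ne_zero), Real.sin_arcsin, abs_of_nonneg (le_max_left _ _)]
  · rcases le_total (2 - r / r0) 0 with h1 | h1
    · rw [max_eq_left ((min_le_right _ _).trans h1)]
      simp; exact h.le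
    · rw [max_eq_right (le_min zero_le_one h1)]
      have : r * (2 - r / r0) ≤ r0 := by
        have e : r0 - r * (2 - r / r0) = (r - r0) ^ 2 / r0 := by field_simp; ring
        have : 0 ≤ (r - r0) ^ 2 / r0 := by positivity
        linarith
      have h2 : r * min 1 (2 - r / r0) ≤ r * (2 - r / r0) :=
        mul_le_mul_of_nonneg_left (min_le_right _ _) hr
      linarith
  · linarith [le_max_left 0 (min 1 (2 - r / r0))]
  · exact max_le zero_le_one (min_le_left _ _)

open Classical in
/-- periodic twist about the centre `c` -/
def ptw (θ : ℝ → ℝ) (c : R2) (x : R2) : R2 :=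
  if h : ∃ l ∈ intLattice, ‖x - c - l‖ < 1 / 2 then
    h.choose + c + tw θ (x - c - h.choose) else x

lemma ptw_near (θ : ℝ → ℝ) (c : R2) {x l : R2} (hl : l ∈ intLattice) (h : ‖x - c - l‖ < 1 / 2) :
    ptw θ c x = l + c + tw θ (x - c - l) := by
  have hex : ∃ l ∈ intLattice, ‖x - c - l‖ < 1 / 2 := ⟨l, hl, h⟩
  have e : hex.choose = l := by
    obtain ⟨h1, h2⟩ := hex.choose_spec
    refine lat_eq_of_close h1 hl ?_
    have : hex.choose - l = (x - c - l) - (x - c - hex.choose) := by abel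
    rw [this]
    exact (norm_sub_le _ _).trans_lt (by linarith)
  rw [ptw, dif_pos hex, e]

lemma ptw_far (θ : ℝ → ℝ) (c : R2) {x : R2} {ρ : ℝ} (hθ : ∀ r, ρ ≤ r → θ r = 0)
    (h : ∀ l ∈ intLattice, ρ ≤ ‖x - c - l‖) : ptw θ c x = x := by
  by_cases hex : ∃ l ∈ intLattice, ‖x - c - l‖ < 1 / 2
  · obtain ⟨l, hl, h1⟩ := hex
    rw [ptw_near θ c hl h1, tw_of_zero (hθ _ (h l hl))]
    abel
  · rw [ptw, dif_neg hex]

lemma ptw_equiv (θ : ℝ → ℝ) (c : R2) (x w : R2) (hw : w ∈ intLattice) :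
    ptw θ c (x + w) = ptw θ c x + w := by
  by_cases hex : ∃ l ∈ intLattice, ‖x - c - l‖ < 1 / 2
  · obtain ⟨l, hl, h1⟩ := hex
    have e : x + w - c - (l + w) = x - c - l := by abel
    rw [ptw_near θ c hl h1, ptw_near θ c (intLattice.add_mem hl hw) (by rw [e]; exact h1), e]
    abel
  · have : ¬ ∃ l ∈ intLattice, ‖x + w - c - l‖ < 1 / 2 := by
      rintro ⟨l, hl, h1⟩
      exact hex ⟨l - w, intLattice.sub_mem hl hw, by
        rwa [show x - c - (l - w) = x + w - c - l by abel]⟩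
    rw [ptw, dif_neg this, ptw, dif_neg hex]

lemma ptw_inv (θ : ℝ → ℝ) (c : R2) (x : R2) :
    ptw (fun r => - θ r) c (ptw θ c x) = x := by
  by_cases hex : ∃ l ∈ intLattice, ‖x - c - l‖ < 1 / 2
  · obtain ⟨l, hl, h1⟩ := hex
    rw [ptw_near θ c hl h1]
    have e : l + c + tw θ (x - c - l) - c - l = tw θ (x - c - l) := by abel
    rw [ptw_near _ c hl (by rw [e, tw_norm]; exact h1), e, tw_inv]
    abel
  · rw [ptw.eq_1 θ, dif_neg hex, ptw, dif_neg hex]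

lemma ptw_cont {θ : ℝ → ℝ} (hc : Continuous θ) (c : R2) {ρ : ℝ} (hρ : ρ < 1 / 2)
    (hθ : ∀ r, ρ ≤ r → θ r = 0) : Continuous (ptw θ c) := by
  rw [continuous_iff_continuousAt]
  intro x
  by_cases hex : ∃ l ∈ intLattice, ‖x - c - l‖ < 1 / 2
  · obtain ⟨l, hl, h1⟩ := hex
    have h2 : ∀ᶠ y in 𝓝 x, l + c + tw θ (y - c - l) = ptw θ c y := by
      have ho : IsOpen {y : R2 | ‖y - c - l‖ < 1 / 2} :=
        isOpen_lt (by fun_prop) continuous_const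
      filter_upwards [ho.mem_nhds h1] with y hy
      exact (ptw_near θ c hl hy).symm
    refine ContinuousAt.congr ?_ h2
    have := tw_cont hc
    exact Continuous.continuousAt (by fun_prop)
  · push Not at hex
    have h2 : ∀ᶠ y in 𝓝 x, y = ptw θ c y := by
      filter_upwards [Metric.ball_mem_nhds x (show 0 < 1 / 2 - ρ by linarith)] with y hy
      refine (ptw_far θ c hθ fun l hl => ?_).symm
      have h3 := hex l hl
      rw [Metric.mem_ball, dist_eq_norm] at hy
      have h4 : ‖x - c - l‖ ≤ ‖y - c - l‖ + ‖y - x‖ := by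
        rw [show x - c - l = (y - c - l) - (y - x) by abel]
        exact norm_sub_le _ _
      linarith
    exact continuousAt_id.congr h2

def ptwHomeo {θ : ℝ → ℝ} (hc : Continuous θ) (c : R2) {ρ : ℝ} (hρ : ρ < 1 / 2)
    (hθ : ∀ r, ρ ≤ r → θ r = 0) : R2 ≃ₜ R2 where
  toFun := ptw θ c
  invFun := ptw (fun r => - θ r) c
  left_inv := ptw_inv θ c
  right_inv := by
    intro x
    have := ptw_inv (fun r => - θ r) c x
    simpa using this
  continuous_toFun := ptw_cont hc c hρ hθ
  continuous_invFun := ptw_cont hc.neg c hρ (fun r hr => by simp [hθ r hr])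

lemma ptw_good {θ : ℝ → ℝ} (hc : Continuous θ) (c : R2) {ρ : ℝ} (hρ : ρ < 1 / 2)
    (hθ : ∀ r, ρ ≤ r → θ r = 0) : Good (ptwHomeo hc c hρ hθ) := by
  obtain ⟨h, hh⟩ := descend (ptwHomeo hc c hρ hθ) (ptw_equiv θ c)
  refine ⟨h, hh, h.continuous.measurable, ?_⟩
  set u : R2 := c - !₂[(1/2:ℝ), (1/2:ℝ)] with hu
  let T : R2 → R2 := fun x => tw θ (x - c) + c
  have hT : MeasurePreserving T (volume : Measure R2) volume :=
    (measurePreserving_add_right volume c).comp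
      ((tw_mp hc).comp (measurePreserving_sub_right volume c))
  have hcoord : ∀ x ∈ fdom u, ∀ i, |(x - c) i| ≤ 1 / 2 := by
    intro x hx i
    have := hx i
    rw [abs_le]
    fin_cases i <;> simp [hu] at this ⊢ <;> constructor <;> linarith [this.1, this.2]
  have hball : ∀ x : R2, ‖x - c‖ < 1 / 2 → x ∈ fdom u := by
    intro x hx i
    have h1 := (PiLp.norm_apply_le (x - c) i).trans_lt hx
    rw [Real.norm_eq_abs, abs_lt] at h1
    fin_cases i <;> simp [hu] at h1 ⊢ <;> constructor <;> linarith [h1.1, h1.2]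
  have hTeq : ∀ x ∈ fdom u, ptw θ c x = T x := by
    intro x hx
    by_cases h1 : ‖x - c‖ < 1 / 2
    · rw [ptw_near θ c intLattice.zero_mem (by simpa using h1)]
      simp only [T, sub_zero]; abel
    · have h2 : T x = x := by
        simp only [T]
        rw [tw_of_zero (hθ _ (by linarith))]; abel
      rw [h2]
      refine ptw_far θ c hθ fun l hl => ?_
      by_cases h0 : l = 0
      · rw [h0, sub_zero]; linarith
      · have : ∃ i, l i ≠ 0 := by
          by_contra! h
          exact h0 (by ext i; simpa using h i)
        obtain ⟨i, hi⟩ := this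
        obtain ⟨n, hn⟩ := hl i
        have h3 : (1:ℝ) ≤ |l i| := by
          rw [hn] at hi ⊢
          have : n ≠ 0 := by rintro rfl; simp at hi
          have h2 : (1:ℤ) ≤ |n| := Int.one_le_abs this
          rw [← Int.cast_abs]
          exact_mod_cast h2
        have h4 := PiLp.norm_apply_le (x - c - l) i
        have h5 := hcoord x hx i
        rw [Real.norm_eq_abs] at h4
        have h6 : |l i| ≤ |(x - c) i| + |(x - c - l) i| := by
          have : l i = (x - c) i - (x - c - l) i := by simp
          rw [this]; exact abs_sub _ _
        linarith
  have hTdom : ∀ x, T x ∈ fdom u ↔ x ∈ fdom u := by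
    intro x
    by_cases h1 : ‖x - c‖ < 1 / 2
    · refine iff_of_true (hball _ ?_) (hball _ h1)
      simpa [T, tw_norm] using h1
    · have h2 : T x = x := by
        simp only [T]
        rw [tw_of_zero (hθ _ (by linarith))]; abel
      rw [h2]
  ext A hA
  rw [Measure.map_apply h.continuous.measurable hA, leb_apply hA u,
    leb_apply (h.continuous.measurable hA) u]
  have hB : MeasurableSet (pr ⁻¹' A) := pr_cont.measurable hA
  rw [← hT.measure_preimage (hB.inter (fdom_meas u)).nullMeasurableSet]
  congr 1
  ext x
  simp only [mem_inter_iff, mem_preimage, hTdom]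
  refine and_congr_left fun hx => ?_
  rw [← hh.proj]
  show pr (ptw θ c x) ∈ A ↔ _
  rw [hTeq x hx]

/-- Elementary move. -/
lemma elem_move (a b : R2) (d : ℝ) (hd : dist a b ≤ d) (hd2 : d < 1 / 2) :
    ∃ H : R2 ≃ₜ R2, Good H ∧ H a = b ∧ (∀ x, dist (H x) x ≤ d) ∧
      ∀ x, (∀ l ∈ intLattice, d ≤ ‖x - midpoint ℝ a b - l‖) → H x = x := by
  have hd0 : 0 ≤ d := dist_nonneg.trans hd
  by_cases hab : a = b
  · exact ⟨Homeomorph.refl _, Good.refl, hab, by simpa using hd0, fun x _ => rfl⟩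
  set c := midpoint ℝ a b with hcdef
  set r0 := dist a b / 2 with hr0
  have hpos : 0 < r0 := by have := dist_pos.2 hab; positivity
  have hρ : 2 * r0 < 1 / 2 := by rw [hr0]; linarith
  have hθ : ∀ r, 2 * r0 ≤ r → ang r0 r = 0 := fun r hr => ang_zero hpos hr
  have hac : ‖a - c‖ = r0 := by
    rw [← dist_eq_norm, hcdef, dist_left_midpoint, hr0]
    simp; ring
  refine ⟨ptwHomeo (ang_cont r0) c hρ hθ, ptw_good _ _ _ _, ?_, ?_, ?_⟩
  · show ptw (ang r0) c a = b
    rw [ptw_near _ c intLattice.zero_mem (by rw [sub_zero, hac]; linarith), sub_zero,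
      tw_of_pi (by rw [hac, ang_at hpos])]
    have : c + c = a + b := by rw [hcdef]; exact midpoint_add_self ℝ a b
    rw [zero_add, neg_sub, ← add_sub_assoc, this]; abel
  · intro x
    show dist (ptw (ang r0) c x) x ≤ d
    by_cases hex : ∃ l ∈ intLattice, ‖x - c - l‖ < 1 / 2
    · obtain ⟨l, hl, h1⟩ := hex
      rw [ptw_near _ c hl h1, dist_eq_norm]
      rw [show l + c + tw (ang r0) (x - c - l) - x = tw (ang r0) (x - c - l) - (x - c - l) by abel]
      rw [tw_disp]
      exact (ang_disp hpos (norm_nonneg _)).trans (by rw [hr0]; linarith)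
    · rw [ptw, dif_neg hex]; simpa using hd0
  · intro x hx
    exact ptw_far _ c hθ fun l hl => le_trans (by rw [hr0]; linarith) (hx l hl)

lemma lat_closed : IsClosed (intLattice : Set R2) := by
  have : (intLattice : Set R2) = ⋂ i, (fun x : R2 => x i) ⁻¹' (Set.range ((↑) : ℤ → ℝ)) := by
    ext x
    simp only [mem_iInter, mem_preimage, mem_range]
    exact forall_congr' fun i => exists_congr fun n => eq_comm
  rw [this]
  refine isClosed_iInter fun i => ?_
  exact Int.isClosedEmbedding_coe_real.isClosed_range.preimage (by fun_prop)

lemma step_move {ι : Type} [Fintype ι] [DecidableEq ι] (a b : ι → R2) (d : ℝ) (hd0 : 0 < d)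
    (hd2 : d < 1 / 2) (hab : ∀ i, dist (a i) (b i) ≤ d)
    (hsep : ∀ i j, i ≠ j → ∀ l ∈ intLattice,
      2 * d ≤ ‖midpoint ℝ (a i) (b i) - midpoint ℝ (a j) (b j) - l‖) :
    ∃ H : R2 ≃ₜ R2, Good H ∧ (∀ i, H (a i) = b i) ∧ ∀ x, dist (H x) x ≤ d := by
  choose K hK1 hK2 hK3 hK4 using fun i => elem_move (a i) (b i) d (hab i) hd2
  let U : ι → Set R2 := fun i => {x | ∃ l ∈ intLattice, ‖x - midpoint ℝ (a i) (b i) - l‖ < d}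
  have hdis : ∀ i j x, i ≠ j → x ∈ U i → x ∉ U j := by
    rintro i j x hij ⟨l, hl, h1⟩ ⟨m, hm, h2⟩
    have h3 := hsep i j hij (m - l) (intLattice.sub_mem hm hl)
    have e : midpoint ℝ (a i) (b i) - midpoint ℝ (a j) (b j) - (m - l)
      = (x - midpoint ℝ (a j) (b j) - m) - (x - midpoint ℝ (a i) (b i) - l) := by abel
    rw [e] at h3
    have := norm_sub_le (x - midpoint ℝ (a j) (b j) - m) (x - midpoint ℝ (a i) (b i) - l)
    linarith
  have hfix : ∀ i x, x ∉ U i → K i x = x := by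
    intro i x hx
    refine hK4 i x fun l hl => ?_
    by_contra! h
    exact hx ⟨l, hl, h⟩
  have hinv : ∀ i x, x ∈ U i → K i x ∈ U i := by
    intro i x hx
    by_contra h
    have := (K i).injective (hfix i _ h)
    rw [this] at h
    exact h hx
  have haU : ∀ i, a i ∈ U i := by
    intro i
    refine ⟨0, intLattice.zero_mem, ?_⟩
    rw [sub_zero, ← dist_eq_norm, dist_left_midpoint]
    have := hab i
    norm_num
    linarith
  have hbU : ∀ i, b i ∈ U i := fun i => by rw [← hK2 i]; exact hinv i _ (haU i)
  have main : ∀ s : Finset ι, ∃ H : R2 ≃ₜ R2, Good H ∧ (∀ x, (∀ i ∈ s, x ∉ U i) → H x = x) ∧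
      (∀ i ∈ s, ∀ x ∈ U i, H x ∈ U i ∧ dist (H x) x ≤ d) ∧ ∀ i ∈ s, H (a i) = b i := by
    intro s
    induction s using Finset.induction_on with
    | empty => exact ⟨Homeomorph.refl _, Good.refl, by simp, by simp, by simp⟩
    | insert j s hj ih =>
      obtain ⟨H, h1, h2, h3, h4⟩ := ih
      have hjs : ∀ x ∈ U j, H x = x := fun x hx => h2 x fun i hi =>
        hdis j i x (by rintro rfl; exact hj hi) hx
      refine ⟨H.trans (K j), h1.trans (hK1 j), ?_, ?_, ?_⟩
      · intro x hx
        have e := h2 x fun i hi => hx i (Finset.mem_insert_of_mem hi)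
        show K j (H x) = x
        rw [e]
        exact hfix j x (hx j (Finset.mem_insert_self _ _))
      · intro i hi x hx
        show K j (H x) ∈ U i ∧ dist (K j (H x)) x ≤ d
        rcases Finset.mem_insert.1 hi with rfl | hi'
        · rw [hjs x hx]
          exact ⟨hinv _ _ hx, hK3 _ _⟩
        · obtain ⟨h5, h6⟩ := h3 i hi' x hx
          rw [hfix j _ (hdis i j _ (by rintro rfl; exact hj hi') h5)]
          exact ⟨h5, h6⟩
      · intro i hi
        show K j (H (a i)) = b i
        rcases Finset.mem_insert.1 hi with rfl | hi'
        · rw [hjs _ (haU _), hK2]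
        · rw [h4 i hi']
          exact hfix j _ (hdis i j _ (by rintro rfl; exact hj hi') (hbU i))
  obtain ⟨H, h1, h2, h3, h4⟩ := main Finset.univ
  refine ⟨H, h1, fun i => h4 i (Finset.mem_univ _), fun x => ?_⟩
  by_cases hx : ∃ i, x ∈ U i
  · obtain ⟨i, hi⟩ := hx
    exact (h3 i (Finset.mem_univ _) x hi).2
  · push Not at hx
    rw [h2 x fun i _ => hx i]
    simpa using hd0.le

lemma big_move {ι : Type} [Fintype ι] [DecidableEq ι] (a b : ι → R2) (D : ℝ) (hD : 0 < D)
    (hab : ∀ i, dist (a i) (b i) ≤ D)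
    (hsep : ∀ i j, i ≠ j → ∀ t ∈ Icc (0:ℝ) 1,
      AffineMap.lineMap (a i) (b i) t - AffineMap.lineMap (a j) (b j) t ∉ intLattice) :
    ∃ H : R2 ≃ₜ R2, Good H ∧ (∀ i, H (a i) = b i) ∧ ∀ x, dist (H x) x ≤ D := by
  let γ : ι → ℝ → R2 := fun i t => AffineMap.lineMap (a i) (b i) t
  have hγ : ∀ i, Continuous (γ i) := fun i => AffineMap.lineMap_continuous
  have hm : ∀ p : ι × ι, ∃ m : ℝ, 0 < m ∧ (p.1 ≠ p.2 → ∀ t ∈ Icc (0:ℝ) 1, ∀ l ∈ intLattice,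
      m ≤ ‖γ p.1 t - γ p.2 t - l‖) := by
    rintro ⟨i, j⟩
    by_cases hij : i = j
    · exact ⟨1, one_pos, fun h => absurd hij h⟩
    have hcont : Continuous fun t => infDist (γ i t - γ j t) (intLattice : Set R2) :=
      (continuous_infDist_pt _).comp ((hγ i).sub (hγ j))
    obtain ⟨t0, ht0, hmin⟩ := (isCompact_Icc (a := (0:ℝ)) (b := 1)).exists_isMinOn
      (nonempty_Icc.2 zero_le_one) hcont.continuousOn
    refine ⟨infDist (γ i t0 - γ j t0) (intLattice : Set R2), ?_, fun _ t ht l hl => ?_⟩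
    · exact (lat_closed.notMem_iff_infDist_pos ⟨0, intLattice.zero_mem⟩).1 (hsep i j hij t0 ht0)
    · refine (hmin ht).trans ?_
      rw [← dist_eq_norm]
      exact infDist_le_dist_of_mem hl
  choose m hm0 hm1 using hm
  have hlim : Tendsto (fun N : ℕ => D / (N : ℝ)) atTop (𝓝 0) :=
    tendsto_const_div_atTop_nhds_zero_nat D
  have e1 : ∀ᶠ N : ℕ in atTop, D / (N : ℝ) < 1 / 2 := hlim.eventually (gt_mem_nhds (by norm_num))
  have e2 : ∀ᶠ N : ℕ in atTop, ∀ p, D / (N : ℝ) < m p / 2 :=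
    eventually_all.2 fun p => hlim.eventually (gt_mem_nhds (half_pos (hm0 p)))
  obtain ⟨N, hN1, hN2, hN0⟩ := (e1.and (e2.and (eventually_gt_atTop 0))).exists
  have hN : (0:ℝ) < N := by exact_mod_cast hN0
  have main : ∀ k : ℕ, k ≤ N → ∃ H : R2 ≃ₜ R2, Good H ∧ (∀ i, H (a i) = γ i (k / N)) ∧
      ∀ x, dist (H x) x ≤ k * (D / N) := by
    intro k
    induction k with
    | zero => intro _; exact ⟨Homeomorph.refl _, Good.refl, by simp [γ], by simp⟩
    | succ k ih =>
      intro hk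
      obtain ⟨H, h1, h2, h3⟩ := ih (by omega)
      have hk' : (k:ℝ) + 1 ≤ N := by exact_mod_cast hk
      obtain ⟨K, k1, k2, k3⟩ := step_move (fun i => γ i (k / N)) (fun i => γ i ((k + 1 : ℕ) / N))
        (D / N) (by positivity) hN1 (by
          intro i
          simp only [γ]
          rw [dist_lineMap_lineMap, Real.dist_eq]
          have : |(k:ℝ) / N - ((k + 1 : ℕ):ℝ) / N| = 1 / N := by
            rw [← sub_div]; push_cast
            rw [show (k:ℝ) - (k + 1) = -1 by ring, abs_div, abs_neg, abs_one, abs_of_pos hN]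
          rw [this, div_mul_eq_mul_div, one_mul]
          exact div_le_div_of_nonneg_right (hab i) hN.le) (by
          intro i j hij l hl
          have hmid : ∀ i, midpoint ℝ (γ i (k / N)) (γ i ((k + 1 : ℕ) / N))
              = γ i ((k + 1 / 2) / N) := by
            intro i
            simp only [γ]
            rw [midpoint_eq_smul_add, invOf_eq_inv]
            simp only [AffineMap.lineMap_apply_module']
            push_cast
            module
          simp only [hmid]
          refine le_trans ?_ (hm1 (i, j) hij ((k + 1 / 2) / N) ⟨by positivity, ?_⟩ l hl)
          · linarith [hN2 (i, j)]
          · rw [div_le_one hN]; linarith)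
      refine ⟨H.trans K, h1.trans k1, fun i => ?_, fun x => ?_⟩
      · show K (H (a i)) = _
        rw [h2, k2]
      · show dist (K (H x)) x ≤ _
        refine (dist_triangle _ (H x) _).trans ?_
        have := k3 (H x)
        have := h3 x
        push_cast
        linarith
  obtain ⟨H, h1, h2, h3⟩ := main N le_rfl
  refine ⟨H, h1, fun i => ?_, fun x => ?_⟩
  · rw [h2, div_self hN.ne']; simp [γ]
  · refine (h3 x).trans_eq ?_
    field_simp

lemma dense_lines (p c : R2) (hp : p ∉ intLattice) :
    Dense {s : R2 | ∀ t ∈ Icc (0:ℝ) 1, (1 - t) • p + t • (s + c) ∉ intLattice} := by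
  have h1 : ∀ m : intLattice, ∀ᵐ s : R2,
      s ∉ (AffineSubspace.mk' (p - c) (Submodule.span ℝ {(m : R2) - p}) : Set R2) := by
    intro m
    rw [ae_iff]
    simp only [not_not]
    refine Measure.addHaar_affineSubspace volume _ ?_
    intro h
    have h2 := congrArg AffineSubspace.direction h
    rw [AffineSubspace.direction_mk', AffineSubspace.direction_top] at h2
    have h3 := finrank_span_le_card (R := ℝ) ({(m : R2) - p} : Set R2)
    rw [h2, finrank_top] at h3
    simp at h3
  have h2 := ae_all_iff.2 h1
  refine (Measure.dense_of_ae h2).mono ?_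
  intro s hs t ht hmem
  refine hs ⟨_, hmem⟩ ?_
  have ht0 : t ≠ 0 := by
    rintro rfl
    simp at hmem
    exact hp hmem
  show s ∈ AffineSubspace.mk' _ _
  rw [AffineSubspace.mem_mk', Submodule.mem_span_singleton]
  refine ⟨t⁻¹, ?_⟩
  have : (1 - t) • p + t • (s + c) - p = t • (s + c - p) := by module
  simp only [this, smul_smul, inv_mul_cancel₀ ht0, one_smul, vsub_eq_sub]
  module

lemma gen_pos {ι : Type} [Fintype ι] [DecidableEq ι] (F : R2 ≃ₜ R2) (σ : ι → ι)
    (hσ : Function.Injective σ) (h1 : ∀ i, σ i ≠ i) (h2 : ∀ i, σ (σ i) ≠ i) (L : ι → R2) :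
    Dense {x : ι → R2 | ∀ i j, i ≠ j → ∀ t ∈ Icc (0:ℝ) 1,
      AffineMap.lineMap (F (x i)) (x (σ i) + L i) t
        - AffineMap.lineMap (F (x j)) (x (σ j) + L j) t ∉ intLattice} := by
  let U : ι → ι → Set (ι → R2) := fun i j => {x | ∀ t ∈ Icc (0:ℝ) 1,
      AffineMap.lineMap (F (x i)) (x (σ i) + L i) t
        - AffineMap.lineMap (F (x j)) (x (σ j) + L j) t ∉ intLattice}
  have hsym : ∀ i j, U i j = U j i := by
    intro i j
    ext x
    simp only [U, mem_ofPred_eq]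
    refine forall₂_congr fun t _ => ?_
    rw [← neg_mem_iff, neg_sub]
  have hopen : ∀ i j, IsOpen (U i j) := by
    intro i j
    let C : Set (Icc (0:ℝ) 1 × (ι → R2)) := {q |
      AffineMap.lineMap (F (q.2 i)) (q.2 (σ i) + L i) (q.1 : ℝ)
        - AffineMap.lineMap (F (q.2 j)) (q.2 (σ j) + L j) (q.1 : ℝ) ∈ intLattice}
    have hC : IsClosed C := by
      refine lat_closed.preimage ?_
      have := F.continuous
      simp only [AffineMap.lineMap_apply_module]
      fun_prop
    have := (isClosedMap_snd_of_compactSpace _ hC).isOpen_compl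
    convert this using 1
    ext x
    simp only [U, C, mem_ofPred_eq, mem_compl_iff, mem_image, Prod.exists, Subtype.exists,
      exists_eq_right, not_exists]
  have hdense0 : ∀ i j, i ≠ j → Dense {x : ι → R2 | F (x i) - F (x j) ∉ intLattice} := by
    intro i j hij x
    have hd : Dense {s : R2 | F s - F (x j) ∉ intLattice} := by
      have hc : ({s : R2 | F s - F (x j) ∈ intLattice}).Countable := by
        have : {s : R2 | F s - F (x j) ∈ intLattice} ⊆
            range (fun l : intLattice => F.symm (l + F (x j))) := by
          intro s hs
          exact ⟨⟨_, hs⟩, by simp⟩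
        exact (countable_range _).mono this
      exact hc.dense_compl ℝ
    have := map_mem_closure (f := fun s => Function.update x i s) (by fun_prop) (hd (x i))
      (t := {x : ι → R2 | F (x i) - F (x j) ∉ intLattice}) (by
        intro s hs
        simp only [mem_ofPred_eq, Function.update_self, Function.update_of_ne hij.symm]
        exact hs)
    simpa using this
  have hdense1 : ∀ i j, i ≠ j → σ i ≠ j → Dense (U i j) := by
    intro i j hij hs
    refine Dense.of_closure ((hdense0 i j hij).mono fun x hx => ?_)
    have hd := dense_lines (F (x i) - F (x j)) (L i - x (σ j) - L j) hx
    have := map_mem_closure (f := fun s => Function.update x (σ i) s) (by fun_prop) (hd (x (σ i)))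
      (t := U i j) (by
        intro s hs' t ht
        have e : σ j ≠ σ i := fun h => hij (hσ h).symm
        simp only [Function.update_self, Function.update_of_ne hs.symm,
          Function.update_of_ne (h1 i).symm, Function.update_of_ne e,
          AffineMap.lineMap_apply_module]
        convert hs' t ht using 2
        module)
    simpa using this
  have hdense : ∀ i j, i ≠ j → Dense (U i j) := by
    intro i j hij
    by_cases h : σ i = j
    · rw [hsym]
      exact hdense1 j i hij.symm (by rw [← h]; exact h2 i)
    · exact hdense1 i j hij h
  have key : Dense (⋂ q : {q : ι × ι // q.1 ≠ q.2}, U q.1.1 q.1.2) :=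
    dense_iInter_of_isOpen (fun q => hopen _ _) (fun q => hdense _ _ q.2)
  refine key.mono fun x hx i j hij => ?_
  exact mem_iInter.1 hx ⟨(i, j), hij⟩

/-- walks of a relation -/
def Wk (R : R2 → R2 → Prop) : ℕ → R2 → R2 → Prop
  | 0, x, y => x = y
  | n + 1, x, y => ∃ z, Wk R n x z ∧ R z y

lemma Wk.trans {R : R2 → R2 → Prop} {m : ℕ} {x y : R2} (h : Wk R m x y) :
    ∀ {n : ℕ} {z : R2}, Wk R n y z → Wk R (m + n) x z
  | 0, z, h' => by cases h'; exact h
  | n + 1, z, ⟨w, hw, hr⟩ => ⟨w, h.trans hw, hr⟩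

lemma Wk.mono {R R' : R2 → R2 → Prop} (hR : ∀ x y, R x y → R' x y) :
    ∀ {n : ℕ} {x y : R2}, Wk R n x y → Wk R' n x y
  | 0, _, _, h => h
  | _ + 1, _, _, ⟨w, hw, hr⟩ => ⟨w, Wk.mono hR hw, hR _ _ hr⟩

lemma Wk.one {R : R2 → R2 → Prop} {x y : R2} (h : R x y) : Wk R 1 x y := ⟨x, rfl, h⟩

lemma Wk.seq {R : R2 → R2 → Prop} : ∀ {n : ℕ} {x y : R2}, Wk R n x y →
    ∃ s : ℕ → R2, s 0 = x ∧ s n = y ∧ ∀ i < n, R (s i) (s (i + 1))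
  | 0, x, y, h => ⟨fun _ => x, rfl, h, by simp⟩
  | n + 1, x, y, ⟨w, hw, hr⟩ => by
    obtain ⟨s, h0, h1, h2⟩ := Wk.seq hw
    refine ⟨fun i => if i ≤ n then s i else y, by simp [h0], by simp, fun i hi => ?_⟩
    rcases Nat.lt_succ_iff_lt_or_eq.1 hi with h | rfl
    · simp only [h.le, if_true, show i + 1 ≤ n by omega]
      exact h2 i h
    · simp [h1, hr]

lemma Wk.of_seq {R : R2 → R2 → Prop} {n : ℕ} {s : ℕ → R2} (h : ∀ i < n, R (s i) (s (i + 1))) :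
    ∀ {j i : ℕ}, i + j ≤ n → Wk R j (s i) (s (i + j))
  | 0, _, _ => rfl
  | j + 1, i, hj => ⟨s (i + j), Wk.of_seq h (by omega), h _ (by omega)⟩

def Equi (R : R2 → R2 → Prop) : Prop := ∀ x y : R2, ∀ w ∈ intLattice, R x y → R (x + w) (y + w)

lemma Wk.add {R : R2 → R2 → Prop} (hR : Equi R) {w : R2} (hw : w ∈ intLattice) :
    ∀ {n : ℕ} {x y : R2}, Wk R n x y → Wk R n (x + w) (y + w)
  | 0, _, _, h => by cases h; rfl
  | _ + 1, _, _, ⟨z, hz, hr⟩ => ⟨z + w, Wk.add hR hw hz, hR _ _ _ hw hr⟩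

lemma Wk.iter {R : R2 → R2 → Prop} (hR : Equi R) {l : ℕ} {x L : R2} (hL : L ∈ intLattice)
    (h : Wk R l x (x + L)) : ∀ k : ℕ, Wk R (k * l) x (x + (k:ℝ) • L)
  | 0 => by simp [Wk]
  | k + 1 => by
    have h1 := h.trans (Wk.add hR hL (Wk.iter hR hL h k))
    rw [show (k + 1) * l = l + k * l by ring]
    convert h1 using 1
    push_cast; module

def Ch (F : R2 ≃ₜ R2) (ε : ℝ) : R2 → R2 → Prop := fun x y => dist (F x) y < ε

def Eqv (F : R2 ≃ₜ R2) : Prop := ∀ x : R2, ∀ w ∈ intLattice, F (x + w) = F x + w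

lemma Ch.equi {F : R2 ≃ₜ R2} (hF : Eqv F) (ε : ℝ) : Equi (Ch F ε) := by
  intro x y w hw h
  simp only [Ch, hF x w hw, dist_add_right] at h ⊢
  exact h

lemma iter_eqv {F : R2 ≃ₜ R2} (hF : Eqv F) (n : ℕ) (x w : R2) (hw : w ∈ intLattice) :
    (⇑F)^[n] (x + w) = (⇑F)^[n] x + w := by
  induction n with
  | zero => rfl
  | succ n ih => rw [Function.iterate_succ_apply', Function.iterate_succ_apply', ih, hF _ _ hw]

lemma rot_of_per {G : R2 ≃ₜ R2} (hG : Eqv G) {l : ℕ} (hl : 1 ≤ l) {x L : R2}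
    (hL : L ∈ intLattice) (h : (⇑G)^[l] x = x + L) : (l:ℝ)⁻¹ • L ∈ rotSet G := by
  have hk : ∀ k : ℕ, (⇑G)^[k * l] x = x + (k:ℝ) • L := by
    intro k
    induction k with
    | zero => simp
    | succ k ih =>
      rw [show (k + 1) * l = k * l + l by ring, Function.iterate_add_apply, h,
        iter_eqv hG _ _ _ hL, ih]
      push_cast; module
  refine ⟨fun _ => x, fun k => (k + 1) * l, ?_, ?_⟩
  · refine tendsto_atTop_mono (fun k => ?_) tendsto_id
    simp only [id]
    nlinarith
  · have : (fun k : ℕ => (((k + 1) * l : ℕ) : ℝ)⁻¹ • ((⇑G)^[(k + 1) * l] x - x))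
        = fun _ => (l:ℝ)⁻¹ • L := by
      funext k
      rw [hk, add_sub_cancel_left, smul_smul]
      congr 1
      push_cast
      have : (l:ℝ) ≠ 0 := by positivity
      field_simp
    rw [this]
    exact tendsto_const_nhds

lemma Good.eqv {F : R2 ≃ₜ R2} (h : Good F) : Eqv F := by
  obtain ⟨f, h1, _⟩ := h
  exact h1.equivariant

lemma lemA0 {F : R2 ≃ₜ R2} (hF : Good F) {δ : ℝ} (hδ : 0 < δ) (hs : UpperStable Homeo0Leb F δ)
    {m : ℕ} {x L : R2} (hL : L ∈ intLattice) (h : Wk (Ch F δ) (m + 3) x (x + L)) :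
    ((m + 3 : ℕ):ℝ)⁻¹ • L ∈ rotSet F := by
  obtain ⟨s, s0, s1, s2⟩ := h.seq
  let σ : Fin (m + 3) → Fin (m + 3) := fun i => i + 1
  let Λ : Fin (m + 3) → R2 := fun i => if i = Fin.last (m + 2) then L else 0
  have hd := gen_pos F σ (add_left_injective 1) (by
      intro i h
      have := congrArg Fin.val h
      simp only [σ, Fin.val_add_one] at this
      split_ifs at this with h1
      · simp [h1] at this
      · omega) (by
      intro i h
      have := congrArg Fin.val h
      simp only [σ, Fin.val_add] at this
      have h2 := i.2
      have h3 : ((1 : Fin (m + 3)) : ℕ) = 1 := by simp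
      rw [h3] at this
      rcases Nat.lt_or_ge (i.val + 1 + 1) (m + 3) with h4 | h4
      · rw [Nat.mod_eq_of_lt (by omega : i.val + 1 < m + 3), Nat.mod_eq_of_lt h4] at this
        omega
      · rcases Nat.lt_or_ge (i.val + 1) (m + 3) with h5 | h5
        · rw [Nat.mod_eq_of_lt h5, Nat.mod_eq_sub_mod h4, Nat.mod_eq_of_lt (by omega)] at this
          omega
        · rw [Nat.mod_eq_sub_mod h5, Nat.mod_eq_of_lt (a := _ - _) (by omega),
            Nat.mod_eq_of_lt (by omega)] at this
          omega) Λ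
  have hO : IsOpen {y : Fin (m + 3) → R2 | ∀ i, dist (F (y i)) (y (σ i) + Λ i) < δ} := by
    simp only [ofPred_forall]
    refine isOpen_iInter_of_finite fun i => isOpen_lt ?_ continuous_const
    have := F.continuous
    fun_prop
  have hsucc : ∀ i : Fin (m + 3), i ≠ Fin.last (m + 2) → ((σ i : Fin (m + 3)) : ℕ) = i + 1 := by
    intro i hi
    simp [σ, Fin.val_add_one, hi]
  have hlast : σ (Fin.last (m + 2)) = 0 := by simp [σ]
  obtain ⟨y, hy1, hy2⟩ := hd.inter_open_nonempty _ hO ⟨fun i => s i, by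
    intro i
    by_cases hi : i = Fin.last (m + 2)
    · subst hi
      simp only [Λ, if_true, hlast]
      have := s2 (m + 2) (by omega)
      rw [s1] at this
      simpa [s0, Ch] using this
    · simp only [Λ, hi, if_false, hsucc i hi, add_zero]
      exact s2 i i.2⟩
  obtain ⟨D, hD0, hDδ, hD⟩ : ∃ D, 0 < D ∧ D < δ ∧ ∀ i, dist (F (y i)) (y (σ i) + Λ i) ≤ D := by
    refine ⟨max (δ / 2) (Finset.univ.sup' Finset.univ_nonempty
      fun i => dist (F (y i)) (y (σ i) + Λ i)), ?_, ?_, ?_⟩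
    · exact lt_max_of_lt_left (half_pos hδ)
    · refine max_lt (half_lt_self hδ) ((Finset.sup'_lt_iff _).2 fun i _ => hy1 i)
    · intro i
      exact le_max_of_le_right (Finset.le_sup' (fun i => dist (F (y i)) (y (σ i) + Λ i))
        (Finset.mem_univ i))
  obtain ⟨H, hH1, hH2, hH3⟩ := big_move (fun i => F (y i)) (fun i => y (σ i) + Λ i) D hD0 hD hy2
  have hG := hF.trans hH1
  have hGe := hG.eqv
  obtain ⟨g, hg1, hg2⟩ := hG
  refine hs g ⟨⟨_, hg1⟩, hg2⟩ _ hg1 ?_ ?_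
  · refine lt_of_le_of_lt (ciSup_le fun z => ?_) hDδ
    rw [dist_comm]
    exact hH3 (F z)
  · have hstep : ∀ i, (F.trans H) (y i) = y (σ i) + Λ i := fun i => hH2 i
    have hk : ∀ k : ℕ, ∀ hk : k < m + 3, (⇑(F.trans H))^[k] (y 0) = y ⟨k, hk⟩ := by
      intro k
      induction k with
      | zero => intro _; rfl
      | succ k ih =>
        intro hk
        rw [Function.iterate_succ_apply', ih (by omega), hstep]
        have hne : (⟨k, by omega⟩ : Fin (m + 3)) ≠ Fin.last (m + 2) := by
          intro h
          have := congrArg Fin.val h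
          simp at this
          omega
        simp only [Λ, hne, if_false, add_zero]
        congr 1
        exact Fin.ext (hsucc _ hne)
    refine rot_of_per hGe (by omega) (x := y 0) hL ?_
    show (⇑(F.trans H))^[(m + 2) + 1] (y 0) = y 0 + L
    rw [Function.iterate_succ_apply', hk (m + 2) (by omega), hstep]
    have : (⟨m + 2, by omega⟩ : Fin (m + 3)) = Fin.last (m + 2) := rfl
    rw [this, hlast]
    simp [Λ]

lemma lemA {F : R2 ≃ₜ R2} (hF : Good F) {δ : ℝ} (hδ : 0 < δ) (hs : UpperStable Homeo0Leb F δ)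
    {l : ℕ} (hl : 1 ≤ l) {x L : R2} (hL : L ∈ intLattice) (h : Wk (Ch F δ) l x (x + L)) :
    (l:ℝ)⁻¹ • L ∈ rotSet F := by
  have h3 := Wk.iter (Ch.equi hF.eqv δ) hL h 3
  have hL3 : ((3:ℕ):ℝ) • L ∈ intLattice := by
    rw [Nat.cast_smul_eq_nsmul]
    exact intLattice.nsmul_mem hL 3
  obtain ⟨m, hm⟩ : ∃ m, 3 * l = m + 3 := ⟨3 * l - 3, by omega⟩
  rw [hm] at h3
  have := lemA0 hF hδ hs hL3 h3
  rw [← hm, smul_smul] at this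
  convert this using 2
  push_cast
  have : (l:ℝ) ≠ 0 := by positivity
  field_simp

lemma chain_trans {F : R2 ≃ₜ R2} (hF : Good F) {ε : ℝ} (hε : 0 < ε) (x y : R2) :
    ∃ n : ℕ, 1 ≤ n ∧ ∃ w ∈ intLattice, Wk (Ch F ε) n x (y + w) := by
  have hE := hF.eqv
  let R : Set R2 := {y | ∃ n : ℕ, 1 ≤ n ∧ ∃ w ∈ intLattice, Wk (Ch F ε) n x (y + w)}
  have hRopen : IsOpen R := by
    rw [isOpen_iff_mem_nhds]
    rintro y ⟨n, hn, w, hw, h⟩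
    obtain ⟨m, rfl⟩ : ∃ m, n = m + 1 := ⟨n - 1, by omega⟩
    obtain ⟨z, hz, hr⟩ := h
    have ho : IsOpen {y : R2 | dist (F z) (y + w) < ε} :=
      isOpen_lt (by fun_prop) continuous_const
    filter_upwards [ho.mem_nhds hr] with y' hy'
    exact ⟨m + 1, hn, w, hw, z, hz, hy'⟩
  have hRper : ∀ y ∈ R, ∀ w ∈ intLattice, y + w ∈ R := by
    rintro y ⟨n, hn, w, hw, h⟩ v hv
    refine ⟨n, hn, w - v, intLattice.sub_mem hw hv, ?_⟩
    convert h using 1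
    abel
  have hRF : ∀ y ∈ closure R, F y ∈ R := by
    intro y hy
    have ho : IsOpen {y' : R2 | dist (F y') (F y) < ε} :=
      isOpen_lt (F.continuous.dist continuous_const) continuous_const
    obtain ⟨y', hy', n, hn, w, hw, h⟩ := mem_closure_iff.1 hy _ ho (by simpa using hε)
    refine ⟨n + 1, by omega, w, hw, y' + w, h, ?_⟩
    simp only [Ch, hE _ _ hw, dist_add_right]
    exact hy'
  have hRne : R.Nonempty := ⟨F x, 1, le_rfl, 0, intLattice.zero_mem, x, rfl, by simpa [Ch] using hε⟩
  obtain ⟨f, hf1, hf2⟩ := hF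
  let A : Set T2 := pr '' R
  have hA : IsOpen A := pr_open _ hRopen
  have hpre : pr ⁻¹' A = R := by
    refine Subset.antisymm ?_ (subset_preimage_image _ _)
    rintro y ⟨y', hy', h⟩
    have := hRper y' hy' _ (pr_eq_iff.1 h)
    simpa using this
  have hfB : f '' closure A ⊆ A := by
    rintro _ ⟨b, hb, rfl⟩
    obtain ⟨y, rfl⟩ := pr_surj b
    have hy : y ∈ pr ⁻¹' closure A := hb
    rw [pr_open.preimage_closure_eq_closure_preimage pr_cont, hpre] at hy
    exact ⟨F y, hRF y hy, hf1.proj y⟩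
  have hcl : IsClosed (f '' closure A) := f.isClosedMap _ isClosed_closure
  have hmeas : lebT2 (f '' closure A) = lebT2 (closure A) := by
    rw [← hf2.measure_preimage hcl.measurableSet.nullMeasurableSet, f.injective.preimage_image]
  have hnull : lebT2 (A \ f '' closure A) = 0 := by
    refine le_antisymm ?_ (zero_le)
    calc lebT2 (A \ f '' closure A) ≤ lebT2 (closure A \ f '' closure A) :=
          measure_mono (sdiff_subset_sdiff_left subset_closure)
      _ = lebT2 (closure A) - lebT2 (f '' closure A) :=
          measure_sdiff (hfB.trans subset_closure) hcl.measurableSet.nullMeasurableSet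
            (measure_ne_top _ _)
      _ = 0 := by rw [hmeas, tsub_self]
  have hemp := leb_open_pos (hA.sdiff hcl) hnull
  have hAeq : A = f '' closure A := Subset.antisymm (sdiff_eq_empty.1 hemp) hfB
  have hAcl : IsClosed A := by rw [hAeq]; exact hcl
  have hRcl : IsClosed R := by rw [← hpre]; exact hAcl.preimage pr_cont
  have : R = univ := IsClopen.eq_univ ⟨hRcl, hRopen⟩ hRne
  have hy : y ∈ R := this ▸ mem_univ y
  exact hy

lemma rot_closed (F : R2 ≃ₜ R2) : IsClosed (rotSet F) := by
  have key : ∀ v, (∀ ε > 0, ∀ N : ℕ, ∃ n ≥ N, ∃ z, dist ((n:ℝ)⁻¹ • ((⇑F)^[n] z - z)) v < ε) →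
      v ∈ rotSet F := by
    intro v h
    choose n hn z hz using fun k : ℕ => h (1 / ((k:ℝ) + 1)) (by positivity) k
    refine ⟨z, n, tendsto_atTop_mono hn tendsto_id, ?_⟩
    rw [tendsto_iff_dist_tendsto_zero]
    exact squeeze_zero (fun _ => dist_nonneg) (fun k => (hz k).le)
      tendsto_one_div_add_atTop_nhds_zero_nat
  refine isClosed_of_closure_subset fun v hv => key v fun ε hε N => ?_
  obtain ⟨v', ⟨z, n, h1, h2⟩, hd⟩ := Metric.mem_closure_iff.1 hv (ε / 2) (half_pos hε)
  have e1 := h1.eventually (eventually_ge_atTop N)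
  have e2 := h2.eventually (Metric.ball_mem_nhds v' (half_pos hε))
  obtain ⟨k, hk1, hk2⟩ := (e1.and e2).exists
  refine ⟨n k, hk1, z k, ?_⟩
  have := dist_triangle ((n k:ℝ)⁻¹ • ((⇑F)^[n k] (z k) - z k)) v' v
  rw [dist_comm] at hd
  linarith

def PS (F : R2 ≃ₜ R2) (ε : ℝ) : Set R2 :=
  {v | ∃ l : ℕ, 1 ≤ l ∧ ∃ L ∈ intLattice, (∃ x, Wk (Ch F ε) l x (x + L)) ∧ v = (l:ℝ)⁻¹ • L}

def DS (F : R2 ≃ₜ R2) (ε : ℝ) : Set R2 :=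
  {v | ∃ l : ℕ, 1 ≤ l ∧ ∃ L ∈ intLattice, Wk (Ch F ε) l 0 (0 + L) ∧ v = (l:ℝ)⁻¹ • L}

lemma nsmul_lat {L : R2} (hL : L ∈ intLattice) (k : ℕ) : (k:ℝ) • L ∈ intLattice := by
  rw [Nat.cast_smul_eq_nsmul]
  exact intLattice.nsmul_mem hL k

lemma DS_comb {F : R2 ≃ₜ R2} (hF : Eqv F) {ε : ℝ} {a b : R2} (ha : a ∈ DS F ε) (hb : b ∈ DS F ε)
    {m k : ℕ} (hk : 1 ≤ k) (hm : m ≤ k) :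
    ((m:ℝ) / k) • a + (1 - (m:ℝ) / k) • b ∈ DS F ε := by
  obtain ⟨l, hl, L, hL, h, rfl⟩ := ha
  obtain ⟨l', hl', L', hL', h', rfl⟩ := hb
  obtain ⟨n, rfl⟩ : ∃ n, k = m + n := ⟨k - m, by omega⟩
  have hE := Ch.equi hF ε
  have h1 := Wk.iter hE hL h (m * l')
  have h2 := Wk.iter hE hL' h' (n * l)
  have hM := nsmul_lat hL (m * l')
  have hM' := nsmul_lat hL' (n * l)
  have h3 := h1.trans (y := 0 + ((m * l' : ℕ):ℝ) • L) (Wk.add hE hM h2)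
  refine ⟨m * l' * l + n * l * l', ?_, _, intLattice.add_mem hM hM', ?_, ?_⟩
  · have : 1 ≤ (m + n) * (l * l') := Nat.one_le_iff_ne_zero.2 (by positivity)
    nlinarith
  · convert h3 using 1
    abel
  · have : (0:ℝ) < l := by positivity
    have : (0:ℝ) < l' := by positivity
    have : (0:ℝ) < (m:ℝ) + n := by exact_mod_cast hk
    rw [smul_smul, smul_smul, smul_add, smul_smul, smul_smul]
    push_cast
    congr 2
    · field_simp
    · field_simp
      ring_nf

lemma DS_convex {F : R2 ≃ₜ R2} (hF : Eqv F) (ε : ℝ) : Convex ℝ (closure (DS F ε)) := by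
  have h0 : ∀ a ∈ DS F ε, ∀ b ∈ DS F ε, ∀ t : ℝ, 0 ≤ t → t ≤ 1 →
      t • a + (1 - t) • b ∈ closure (DS F ε) := by
    intro a ha b hb t ht0 ht1
    have hlim : Tendsto (fun k : ℕ => ((⌊t * (k:ℝ)⌋₊ : ℕ) : ℝ) / (k:ℝ)) atTop (𝓝 t) :=
      (tendsto_nat_floor_mul_div_atTop ht0).comp tendsto_natCast_atTop_atTop
    refine mem_closure_of_tendsto ((hlim.smul_const a).add ((hlim.const_sub 1).smul_const b)) ?_
    filter_upwards [eventually_ge_atTop 1] with k hk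
    refine DS_comb hF ha hb hk ?_
    refine Nat.floor_le_of_le ?_
    have : (0:ℝ) ≤ k := Nat.cast_nonneg k
    nlinarith
  intro a ha b hb s t hs ht hst
  have : t = 1 - s := by linarith
  subst this
  have := map_mem_closure₂ (f := fun a b : R2 => s • a + (1 - s) • b) (by fun_prop) ha hb
    (u := closure (DS F ε)) (fun a ha b hb => h0 a ha b hb s hs (by linarith))
  simpa using this

lemma PS_sub {F : R2 ≃ₜ R2} (hF : Good F) {ε : ℝ} (hε : 0 < ε) :
    PS F ε ⊆ closure (DS F ε) := by
  rintro _ ⟨l, hl, L, hL, ⟨x, h⟩, rfl⟩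
  have hE := Ch.equi hF.eqv ε
  obtain ⟨n1, hn1, w1, hw1, h1⟩ := chain_trans hF hε 0 x
  obtain ⟨n2, hn2, w2, hw2, h2⟩ := chain_trans hF hε x 0
  have hk : ∀ k : ℕ, (((n1 + k * l + n2 : ℕ)) : ℝ)⁻¹ • ((w1 + w2) + (k:ℝ) • L) ∈ DS F ε := by
    intro k
    refine ⟨_, by omega, _, ?_, ?_, rfl⟩
    · exact intLattice.add_mem (intLattice.add_mem hw1 hw2) (nsmul_lat hL k)
    · have a1 := h1.trans (Wk.add hE hw1 (Wk.iter hE hL h k))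
      have a2 := Wk.add hE (intLattice.add_mem hw1 (nsmul_lat hL k)) h2
      rw [show x + (w1 + (k:ℝ) • L) = x + (k:ℝ) • L + w1 by abel] at a2
      convert a1.trans a2 using 1
      abel
  refine mem_closure_of_tendsto (b := atTop) ?_ (Eventually.of_forall hk)
  have hl0 : (l:ℝ) ≠ 0 := by positivity
  have lim1 : Tendsto (fun k : ℕ => ((n1 + n2 : ℕ):ℝ) / (k:ℝ) + l) atTop (𝓝 (0 + l)) :=
    (tendsto_const_div_atTop_nhds_zero_nat _).add_const _
  have lim2 : Tendsto (fun k : ℕ => ((1:ℝ) / (k:ℝ)) • (w1 + w2) + L) atTop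
      (𝓝 ((0:ℝ) • (w1 + w2) + L)) :=
    ((tendsto_const_div_atTop_nhds_zero_nat _).smul_const _).add_const _
  rw [zero_add] at lim1
  rw [zero_smul, zero_add] at lim2
  refine ((lim1.inv₀ hl0).smul lim2).congr' ?_
  filter_upwards [eventually_ge_atTop 1] with k hk
  have hk0 : (k:ℝ) ≠ 0 := by positivity
  have : ((1:ℝ) / (k:ℝ)) • (w1 + w2) + L = (1 / (k:ℝ)) • ((w1 + w2) + (k:ℝ) • L) := by
    rw [smul_add (1 / (k:ℝ)) (w1 + w2), smul_smul, one_div_mul_cancel hk0, one_smul]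
  rw [this, smul_smul]
  congr 1
  push_cast
  have : (0:ℝ) < n1 + k * l + n2 := by positivity
  field_simp
  ring_nf

lemma hull_sub {F : R2 ≃ₜ R2} (hF : Good F) {δ : ℝ} (hδ : 0 < δ)
    (hs : UpperStable Homeo0Leb F δ) : convexHull ℝ (PS F δ) ⊆ rotSet F := by
  refine (convexHull_min (PS_sub hF hδ) (DS_convex hF.eqv δ)).trans ?_
  refine closure_minimal ?_ (rot_closed F)
  rintro _ ⟨l, hl, L, hL, h, rfl⟩
  exact lemA hF hδ hs hl hL h

lemma norm_le_two (x : R2) : ‖x‖ ≤ |x 0| + |x 1| := by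
  rw [EuclideanSpace.norm_eq, Fin.sum_univ_two, Real.norm_eq_abs, Real.norm_eq_abs]
  refine Real.sqrt_le_iff.2 ⟨by positivity, ?_⟩
  nlinarith [abs_nonneg (x 0), abs_nonneg (x 1)]

lemma abs_le_norm2 (x : R2) (i : Fin 2) : |x i| ≤ ‖x‖ := by
  rw [← Real.norm_eq_abs]
  exact PiLp.norm_apply_le x i

lemma disp_bound {F : R2 ≃ₜ R2} (hF : Eqv F) : ∃ B : ℝ, ∀ x, ‖F x - x‖ ≤ B := by
  obtain ⟨B, hB⟩ := (isCompact_closedBall (0:R2) 2).exists_bound_of_continuousOn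
    (f := fun x => F x - x) (F.continuous.sub continuous_id).continuousOn
  refine ⟨B, fun x => ?_⟩
  have hw := latVec_mem ⌊x 0⌋ ⌊x 1⌋
  have h := hB (x - latVec ⌊x 0⌋ ⌊x 1⌋) (by
    rw [mem_closedBall_zero_iff]
    refine (norm_le_two _).trans ?_
    have e0 : (x - latVec ⌊x 0⌋ ⌊x 1⌋) 0 = Int.fract (x 0) := by simp [latVec]
    have e1 : (x - latVec ⌊x 0⌋ ⌊x 1⌋) 1 = Int.fract (x 1) := by simp [latVec]
    rw [e0, e1, abs_of_nonneg (Int.fract_nonneg _), abs_of_nonneg (Int.fract_nonneg _)]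
    linarith [Int.fract_lt_one (x 0), Int.fract_lt_one (x 1)])
  have e := hF (x - latVec ⌊x 0⌋ ⌊x 1⌋) _ hw
  rw [sub_add_cancel] at e
  have e2 : F x - x = F (x - latVec ⌊x 0⌋ ⌊x 1⌋) - (x - latVec ⌊x 0⌋ ⌊x 1⌋) := by
    rw [e]; abel
  rw [e2]
  exact h

lemma lat_ball_finite (r : ℝ) : {L : R2 | L ∈ intLattice ∧ ‖L‖ ≤ r}.Finite := by
  have : {L : R2 | L ∈ intLattice ∧ ‖L‖ ≤ r} ⊆
      (fun p : ℤ × ℤ => latVec p.1 p.2) '' (Icc (-⌈r⌉) ⌈r⌉ ×ˢ Icc (-⌈r⌉) ⌈r⌉) := by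
    rintro L ⟨hL, hr⟩
    obtain ⟨a, b, rfl⟩ := lat_exists hL
    refine ⟨(a, b), ?_, rfl⟩
    have h0 := (abs_le_norm2 (latVec a b) 0).trans (hr.trans (Int.le_ceil r))
    have h1 := (abs_le_norm2 (latVec a b) 1).trans (hr.trans (Int.le_ceil r))
    have e0 : latVec a b 0 = (a:ℝ) := by simp [latVec]
    have e1 : latVec a b 1 = (b:ℝ) := by simp [latVec]
    have h0 : |(a:ℝ)| ≤ (⌈r⌉:ℝ) := by rw [← e0]; exact h0
    rw [abs_le] at h0
    have h1 : |(b:ℝ)| ≤ (⌈r⌉:ℝ) := by rw [← e1]; exact h1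
    rw [abs_le] at h1
    simp only [mem_prod, mem_Icc]
    exact ⟨⟨by exact_mod_cast h0.1, by exact_mod_cast h0.2⟩,
      ⟨by exact_mod_cast h1.1, by exact_mod_cast h1.2⟩⟩
  exact ((finite_Icc _ _).prod (finite_Icc _ _)).image _ |>.subset this

lemma Wk.norm_le {R : R2 → R2 → Prop} {B : ℝ} (hB : ∀ x y, R x y → ‖y - x‖ ≤ B) :
    ∀ {n : ℕ} {x y : R2}, Wk R n x y → ‖y - x‖ ≤ n * B
  | 0, x, y, h => by cases h; simp
  | n + 1, x, y, ⟨z, hz, hr⟩ => by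
    have h1 := Wk.norm_le hB hz
    have h2 := hB _ _ hr
    have h3 : ‖y - x‖ ≤ ‖z - x‖ + ‖y - z‖ := by
      rw [show y - x = (z - x) + (y - z) by abel]; exact norm_add_le _ _
    push_cast
    linarith

def QS (R : R2 → R2 → Prop) (M : ℕ) : Set R2 :=
  {v | ∃ l : ℕ, 1 ≤ l ∧ l ≤ M ∧ ∃ L ∈ intLattice, (∃ x, Wk R l x (x + L)) ∧ v = (l:ℝ)⁻¹ • L}

lemma QS_finite {R : R2 → R2 → Prop} {B : ℝ} (hB : ∀ x y, R x y → ‖y - x‖ ≤ B) (M : ℕ) :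
    (QS R M).Finite := by
  have : QS R M ⊆ (fun p : ℕ × R2 => (p.1:ℝ)⁻¹ • p.2) ''
      (Iic M ×ˢ {L : R2 | L ∈ intLattice ∧ ‖L‖ ≤ M * |B|}) := by
    rintro _ ⟨l, hl, hM, L, hL, ⟨x, h⟩, rfl⟩
    refine ⟨(l, L), ⟨hM, hL, ?_⟩, rfl⟩
    have := Wk.norm_le hB h
    rw [add_sub_cancel_left] at this
    refine this.trans ?_
    have : (l:ℝ) ≤ M := by exact_mod_cast hM
    calc (l:ℝ) * B ≤ l * |B| := mul_le_mul_of_nonneg_left (le_abs_self B) (Nat.cast_nonneg l)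
      _ ≤ M * |B| := mul_le_mul_of_nonneg_right this (abs_nonneg B)
  exact ((finite_Iic _).prod (lat_ball_finite _)).image _ |>.subset this

lemma cycle_bound {R : R2 → R2 → Prop} (hE : Equi R) {B : ℝ} (hB0 : 0 ≤ B)
    (hB : ∀ x y, R x y → ‖y - x‖ ≤ B)
    (V : Finset T2) (hV : ∀ x y, R x y → pr x ∈ V) (φ : R2 →L[ℝ] ℝ) (u : ℝ)
    (hu : ∀ v ∈ QS R V.card, φ v ≤ u) :
    ∀ n : ℕ, ∀ x y, Wk R n x y → φ (y - x) ≤ u * n + V.card * (‖φ‖ * B + |u|) := by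
  intro n
  induction n using Nat.strong_induction_on with
  | _ n ih =>
    intro x y h
    by_cases hn : n ≤ V.card
    · have h1 : φ (y - x) ≤ ‖φ‖ * (n * B) :=
        (le_abs_self _).trans ((φ.le_opNorm _).trans
          (mul_le_mul_of_nonneg_left (Wk.norm_le hB h) (norm_nonneg _)))
      have hn' : (n:ℝ) ≤ V.card := by exact_mod_cast hn
      have h2 : -u * n ≤ |u| * n := mul_le_mul_of_nonneg_right (neg_le_abs u) (Nat.cast_nonneg n)
      have h3 : (n:ℝ) * (‖φ‖ * B + |u|) ≤ V.card * (‖φ‖ * B + |u|) :=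
        mul_le_mul_of_nonneg_right hn' (by positivity)
      linarith
    · push Not at hn
      obtain ⟨s, s0, s1, s2⟩ := h.seq
      obtain ⟨i, hi, j, hj, hne, hij⟩ := Finset.exists_ne_map_eq_of_card_lt_of_maps_to
        (s := Finset.range (V.card + 1)) (t := V) (f := fun i => pr (s i)) (by simp) (by
          intro i hi
          have : i < V.card + 1 := by simpa using hi
          exact hV _ _ (s2 i (by omega)))
      wlog hlt : i < j generalizing i j
      · exact this j hj i hi hne.symm hij.symm (by omega)
      have hj' : j < V.card + 1 := by simpa using hj
      obtain ⟨d, rfl⟩ : ∃ d, j = i + d := ⟨j - i, by omega⟩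
      obtain ⟨e, rfl⟩ : ∃ e, n = i + d + e := ⟨n - (i + d), by omega⟩
      have hw : s (i + d) - s i ∈ intLattice := pr_eq_iff.1 hij
      have w1 : Wk R i (s 0) (s (0 + i)) := Wk.of_seq s2 (by omega)
      have w2 : Wk R d (s i) (s (i + d)) := Wk.of_seq s2 (by omega)
      have w3 : Wk R e (s (i + d)) (s (i + d + e)) := Wk.of_seq s2 (by omega)
      rw [zero_add, s0] at w1
      rw [s1] at w3
      have w4 := Wk.add hE (intLattice.neg_mem hw) w3
      rw [show s (i + d) + -(s (i + d) - s i) = s i by abel] at w4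
      have h1 := ih (i + e) (by omega) _ _ (w1.trans w4)
      have hd : 1 ≤ d := by omega
      have hd0 : (0:ℝ) < d := by exact_mod_cast hd
      have h2 := hu ((d:ℝ)⁻¹ • (s (i + d) - s i)) ⟨d, hd, by omega, _, hw, ⟨s i, by
        rw [add_sub_cancel]; exact w2⟩, rfl⟩
      rw [map_smul, smul_eq_mul, inv_mul_le_iff₀ hd0] at h2
      have h3 : φ (y - x) = φ (y + -(s (i + d) - s i) - x) + φ (s (i + d) - s i) := by
        rw [← map_add]; congr 1; abel
      rw [h3]
      push_cast at h1 ⊢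
      linarith

def gam (K : ℕ) (x : R2) : R2 := !₂[(⌊(K:ℝ) * x 0⌋ : ℝ) / K, (⌊(K:ℝ) * x 1⌋ : ℝ) / K]

lemma gam_eqv {K : ℕ} (hK : 1 ≤ K) (x w : R2) (hw : w ∈ intLattice) :
    gam K (x + w) = gam K x + w := by
  obtain ⟨a, b, rfl⟩ := lat_exists hw
  have hK0 : (K:ℝ) ≠ 0 := by positivity
  have key : ∀ (t : ℝ) (c : ℤ), (⌊(K:ℝ) * (t + c)⌋ : ℝ) / K = (⌊(K:ℝ) * t⌋ : ℝ) / K + c := by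
    intro t c
    rw [show (K:ℝ) * (t + c) = (K:ℝ) * t + ((K * c : ℤ) : ℝ) by push_cast; ring,
      Int.floor_add_intCast]
    push_cast
    field_simp
  ext i
  fin_cases i
  · simpa [gam, latVec] using key (x 0) a
  · simpa [gam, latVec] using key (x 1) b

lemma gam_close {K : ℕ} (hK : 1 ≤ K) (x : R2) : ‖gam K x - x‖ ≤ 2 / K := by
  have hK0 : (0:ℝ) < K := by positivity
  have key : ∀ t : ℝ, |(⌊(K:ℝ) * t⌋ : ℝ) / K - t| ≤ 1 / K := by
    intro t
    have h1 := Int.floor_le ((K:ℝ) * t)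
    have h2 := Int.lt_floor_add_one ((K:ℝ) * t)
    rw [show (⌊(K:ℝ) * t⌋ : ℝ) / K - t = (⌊(K:ℝ) * t⌋ - K * t) / K by field_simp, abs_div,
      abs_of_pos hK0]
    refine div_le_div_of_nonneg_right ?_ hK0.le
    rw [abs_le]
    constructor <;> linarith
  refine (norm_le_two _).trans ?_
  have h0 := key (x 0)
  have h1 := key (x 1)
  have e : (2:ℝ) / K = 1 / K + 1 / K := by ring
  rw [e]
  refine add_le_add ?_ ?_
  · simpa [gam] using h0
  · simpa [gam] using h1

lemma gam_finite {K : ℕ} (hK : 1 ≤ K) : (range fun x => pr (gam K x)).Finite := by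
  have hK0 : (K:ℝ) ≠ 0 := by positivity
  have hKz : (0:ℤ) < K := by exact_mod_cast hK
  have : (range fun x => pr (gam K x)) ⊆
      (fun p : ℤ × ℤ => pr !₂[(p.1:ℝ) / K, (p.2:ℝ) / K]) '' (Icc 0 (K:ℤ) ×ˢ Icc 0 (K:ℤ)) := by
    rintro _ ⟨x, rfl⟩
    refine ⟨(⌊(K:ℝ) * x 0⌋ % K, ⌊(K:ℝ) * x 1⌋ % K), ⟨?_, ?_⟩, ?_⟩
    · exact ⟨Int.emod_nonneg _ hKz.ne', (Int.emod_lt_of_pos _ hKz).le⟩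
    · exact ⟨Int.emod_nonneg _ hKz.ne', (Int.emod_lt_of_pos _ hKz).le⟩
    · refine pr_eq_iff.2 ?_
      have key : ∀ c : ℤ, (c:ℝ) / K - ((c % K : ℤ) : ℝ) / K = ((c / K : ℤ) : ℝ) := by
        intro c
        have h := congrArg (Int.cast : ℤ → ℝ) (Int.emod_add_mul_ediv c K)
        push_cast at h
        rw [← sub_div, div_eq_iff hK0]
        linarith
      have e : gam K x - !₂[((⌊(K:ℝ) * x 0⌋ % K : ℤ):ℝ) / K, ((⌊(K:ℝ) * x 1⌋ % K : ℤ):ℝ) / K]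
          = latVec (⌊(K:ℝ) * x 0⌋ / K) (⌊(K:ℝ) * x 1⌋ / K) := by
        ext i
        fin_cases i
        · simpa [gam, latVec] using key ⌊(K:ℝ) * x 0⌋
        · simpa [gam, latVec] using key ⌊(K:ℝ) * x 1⌋
      rw [e]
      exact latVec_mem _ _
  exact ((finite_Icc _ _).prod (finite_Icc _ _)).image _ |>.subset this

lemma rot_sub {F : R2 ≃ₜ R2} (hF : Eqv F) {ε : ℝ} (hε : 0 < ε) :
    ∃ Q : Set R2, Q.Finite ∧ Q ⊆ PS F ε ∧ rotSet F ⊆ convexHull ℝ Q := by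
  obtain ⟨K, hK⟩ := exists_nat_gt (4 / ε)
  have hK1 : 1 ≤ K := by
    have : (0:ℝ) < K := lt_trans (by positivity) hK
    exact_mod_cast this
  have hK0 : (0:ℝ) < K := by exact_mod_cast hK1
  have hclose : ∀ x, ‖gam K x - x‖ < ε / 2 := by
    intro x
    refine (gam_close hK1 x).trans_lt ?_
    rw [div_lt_iff₀ hε] at hK
    rw [div_lt_iff₀ hK0]
    linarith
  obtain ⟨B0, hB0⟩ := disp_bound hF
  let R : R2 → R2 → Prop := fun c c' => ∃ x, gam K x = c ∧ gam K (F x) = c'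
  have hE : Equi R := by
    rintro _ _ w hw ⟨x, rfl, rfl⟩
    exact ⟨x + w, gam_eqv hK1 _ _ hw, by rw [hF _ _ hw, gam_eqv hK1 _ _ hw]⟩
  have hBp : 0 ≤ B0 := (norm_nonneg _).trans (hB0 0)
  have hB : ∀ x y, R x y → ‖y - x‖ ≤ B0 + ε := by
    rintro _ _ ⟨x, rfl, rfl⟩
    have h1 := hclose x
    have h2 := hclose (F x)
    have h3 := hB0 x
    have : gam K (F x) - gam K x = (gam K (F x) - F x) + (F x - x) - (gam K x - x) := by abel
    rw [this]
    refine (norm_sub_le _ _).trans ?_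
    have := norm_add_le (gam K (F x) - F x) (F x - x)
    linarith
  let V := (gam_finite hK1).toFinset
  have hV : ∀ x y, R x y → pr x ∈ V := by
    rintro _ _ ⟨x, rfl, rfl⟩
    simp [V]
  refine ⟨QS R V.card, QS_finite hB _, ?_, ?_⟩
  · rintro _ ⟨l, hl, _, L, hL, ⟨c, h⟩, rfl⟩
    refine ⟨l, hl, L, hL, ?_, rfl⟩
    obtain ⟨s, s0, s1, s2⟩ := h.seq
    have : ∀ i, ∃ x, i < l → gam K x = s i ∧ gam K (F x) = s (i + 1) := by
      intro i
      by_cases hi : i < l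
      · obtain ⟨x, hx⟩ := s2 i hi
        exact ⟨x, fun _ => hx⟩
      · exact ⟨0, fun h => absurd h hi⟩
    choose X hX using this
    let t : ℕ → R2 := fun i => if i < l then X i else X 0 + L
    have ht : ∀ i ≤ l, gam K (t i) = s i := by
      intro i hi
      rcases hi.lt_or_eq with h | rfl
      · simp only [t, h, if_true]
        exact (hX i h).1
      · simp only [t, lt_irrefl, if_false]
        rw [gam_eqv hK1 _ _ hL, (hX 0 (by omega)).1, s0, s1]
    have hstep : ∀ i < l, Ch F ε (t i) (t (i + 1)) := by
      intro i hi
      have e1 : gam K (F (t i)) = s (i + 1) := by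
        simp only [t, hi, if_true]
        exact (hX i hi).2
      have e2 := ht (i + 1) hi
      have h1 := hclose (F (t i))
      have h2 := hclose (t (i + 1))
      rw [e1] at h1
      rw [e2] at h2
      show dist _ _ < ε
      rw [← dist_eq_norm] at h1 h2
      have := dist_triangle_left (F (t i)) (t (i + 1)) (s (i + 1))
      linarith
    refine ⟨X 0, ?_⟩
    have := Wk.of_seq hstep (j := l) (i := 0) (by omega)
    simpa [t, show 0 < l by omega] using this
  · intro v hv
    by_contra hnot
    have hfin := QS_finite hB V.card
    obtain ⟨φ, u, hu, huv⟩ := geometric_hahn_banach_closed_point (convex_convexHull ℝ (QS R V.card))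
      (hfin.isCompact_convexHull (𝕜 := ℝ)).isClosed hnot
    have hu' : ∀ v ∈ QS R V.card, φ v ≤ u := fun v hv => (hu v (subset_convexHull ℝ _ hv)).le
    have hcb := cycle_bound hE (by positivity : (0:ℝ) ≤ B0 + ε) hB V hV φ u hu'
    obtain ⟨z, n, hn, hlim⟩ := hv
    have hwalk : ∀ (k : ℕ) (z : R2), Wk R k (gam K z) (gam K ((⇑F)^[k] z)) := by
      intro k z
      induction k with
      | zero => rfl
      | succ k ih =>
        refine ⟨_, ih, (⇑F)^[k] z, rfl, ?_⟩
        rw [Function.iterate_succ_apply']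
    set C := (V.card : ℝ) * (‖φ‖ * (B0 + ε) + |u|) + ‖φ‖ * ε with hC
    have hb : ∀ (k : ℕ) (z : R2), φ ((⇑F)^[k] z - z) ≤ u * k + C := by
      intro k z
      have h1 := hcb k _ _ (hwalk k z)
      have h2 : (⇑F)^[k] z - z = (gam K ((⇑F)^[k] z) - gam K z)
          + ((gam K z - z) - (gam K ((⇑F)^[k] z) - (⇑F)^[k] z)) := by abel
      have h3 : φ ((gam K z - z) - (gam K ((⇑F)^[k] z) - (⇑F)^[k] z)) ≤ ‖φ‖ * ε := by
        refine (le_abs_self _).trans ((φ.le_opNorm _).trans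
          (mul_le_mul_of_nonneg_left ?_ (norm_nonneg _)))
        refine (norm_sub_le _ _).trans ?_
        linarith [hclose z, hclose ((⇑F)^[k] z)]
      rw [h2, map_add]
      linarith
    have l1 : Tendsto (fun k => φ ((n k : ℝ)⁻¹ • ((⇑F)^[n k] (z k) - z k))) atTop (𝓝 (φ v)) :=
      (φ.continuous.tendsto v).comp hlim
    have l2 : Tendsto (fun k => u + C / (n k : ℝ)) atTop (𝓝 (u + 0)) :=
      ((tendsto_const_div_atTop_nhds_zero_nat C).comp hn).const_add u
    rw [add_zero] at l2
    have : φ v ≤ u := by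
      refine le_of_tendsto_of_tendsto l1 l2 ?_
      filter_upwards [hn.eventually (eventually_ge_atTop 1)] with k hk
      have hk0 : (0:ℝ) < n k := by exact_mod_cast hk
      rw [map_smul, smul_eq_mul, inv_mul_le_iff₀ hk0]
      refine (hb (n k) (z k)).trans (le_of_eq ?_)
      field_simp
    linarith

lemma dvd_of_gcd (l q p a r b : ℤ) (h : l * p = a * q) (h' : l * r = b * q)
    (hg : Int.gcd p (Int.gcd r q) = 1) : q ∣ l := by
  have h1 : q ∣ l * (Int.gcd r q : ℤ) := by
    rw [Int.gcd_eq_gcd_ab r q]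
    exact ⟨b * Int.gcdA r q + l * Int.gcdB r q, by linear_combination (Int.gcdA r q) * h'⟩
  obtain ⟨c, hc⟩ := h1
  have h2 := Int.gcd_eq_gcd_ab p (Int.gcd r q)
  rw [hg] at h2
  refine ⟨a * Int.gcdA p (Int.gcd r q) + c * Int.gcdB p (Int.gcd r q), ?_⟩
  push_cast at h2
  linear_combination l * h2 + (Int.gcdA p (Int.gcd r q)) * h + (Int.gcdB p (Int.gcd r q)) * hc

lemma dvd_period {v L : R2} {p₁ p₂ q : ℤ} (hq : 1 ≤ q) (hg : Int.gcd p₁ (Int.gcd p₂ q) = 1)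
    (h0 : v 0 = (p₁ : ℝ) / (q : ℝ)) (h1 : v 1 = (p₂ : ℝ) / (q : ℝ)) {l : ℕ} (hl : 1 ≤ l)
    (hL : L ∈ intLattice) (hv : v = (l:ℝ)⁻¹ • L) : q ∣ (l : ℤ) := by
  obtain ⟨a, b, rfl⟩ := lat_exists hL
  have hq0 : (q:ℝ) ≠ 0 := by
    have : q ≠ 0 := by omega
    exact_mod_cast this
  have hl0 : (l:ℝ) ≠ 0 := by positivity
  have e0 : v 0 = (l:ℝ)⁻¹ * a := by rw [hv]; simp [latVec]
  have e1 : v 1 = (l:ℝ)⁻¹ * b := by rw [hv]; simp [latVec]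
  refine dvd_of_gcd l q p₁ a p₂ b ?_ ?_ hg
  · have : (p₁ : ℝ) / (q : ℝ) = (l:ℝ)⁻¹ * a := h0.symm.trans e0
    field_simp at this
    rw [mul_comm (l:ℤ), mul_comm _ q]
    exact_mod_cast this
  · have : (p₂ : ℝ) / (q : ℝ) = (l:ℝ)⁻¹ * b := h1.symm.trans e1
    field_simp at this
    rw [mul_comm (l:ℤ), mul_comm _ q]
    exact_mod_cast this

lemma PS_rational {F : R2 ≃ₜ R2} {ε : ℝ} {v : R2} (h : v ∈ PS F ε) : IsRationalPoint v := by
  obtain ⟨l, hl, L, hL, _, rfl⟩ := h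
  intro i
  obtain ⟨n, hn⟩ := hL i
  refine ⟨(l:ℚ)⁻¹ * n, ?_⟩
  push_cast
  rw [← hn]
  rfl

lemma Ch.mono_eps {F : R2 ≃ₜ R2} {ε δ : ℝ} (h : ε ≤ δ) (x y : R2) (hc : Ch F ε x y) : Ch F δ x y :=
  lt_of_lt_of_le hc h

lemma PS_mono {F : R2 ≃ₜ R2} {ε δ : ℝ} (h : ε ≤ δ) : PS F ε ⊆ PS F δ := by
  rintro _ ⟨l, hl, L, hL, ⟨x, hx⟩, rfl⟩
  exact ⟨l, hl, L, hL, ⟨x, hx.mono (Ch.mono_eps h)⟩, rfl⟩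

lemma Wk.change {F : R2 ≃ₜ R2} {ε δ : ℝ} (h : ε ≤ δ) {n : ℕ} (hn : 1 ≤ n) {x y y' : R2}
    (hw : Wk (Ch F ε) n x y) (hy : dist y y' ≤ δ - ε) : Wk (Ch F δ) n x y' := by
  obtain ⟨m, rfl⟩ : ∃ m, n = m + 1 := ⟨n - 1, by omega⟩
  obtain ⟨z, hz, hr⟩ := hw
  refine ⟨z, hz.mono (Ch.mono_eps h), ?_⟩
  have hr' : dist (F z) y < ε := hr
  have := dist_triangle (F z) y y'
  show dist _ _ < δ
  linarith

lemma rot_eq_hull {F : R2 ≃ₜ R2} (hF : Good F) {δ : ℝ} (hδ : 0 < δ)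
    (hs : UpperStable Homeo0Leb F δ) {ε : ℝ} (hε : 0 < ε) (hεδ : ε ≤ δ) :
    ∃ Q : Set R2, Q.Finite ∧ Q ⊆ PS F ε ∧ rotSet F = convexHull ℝ Q := by
  obtain ⟨Q, h1, h2, h3⟩ := rot_sub hF.eqv hε
  exact ⟨Q, h1, h2, Subset.antisymm h3
    ((convexHull_mono (h2.trans (PS_mono hεδ))).trans (hull_sub hF hδ hs))⟩

lemma ext_mem_PS {F : R2 ≃ₜ R2} (hF : Good F) {δ : ℝ} (hδ : 0 < δ)
    (hs : UpperStable Homeo0Leb F δ) {ε : ℝ} (hε : 0 < ε) (hεδ : ε ≤ δ) {v : R2}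
    (hv : v ∈ Set.extremePoints ℝ (rotSet F)) : v ∈ PS F ε := by
  obtain ⟨Q, h1, h2, h3⟩ := rot_eq_hull hF hδ hs hε hεδ
  rw [h3] at hv
  exact h2 (extremePoints_convexHull_subset hv)

lemma pack {r : ℝ} (hr0 : 0 < r) (hr : 2 * r < 1) (s : ℕ → R2) (q : ℕ)
    (hq : 1 < q * (r ^ 2 * Real.pi)) :
    ∃ i j : ℕ, 1 ≤ i ∧ i < j ∧ j ≤ q ∧ ∃ w ∈ intLattice, dist (s j) (s i + w) < 2 * r := by
  suffices h : ∃ i j : ℕ, i ∈ Finset.Icc 1 q ∧ j ∈ Finset.Icc 1 q ∧ i ≠ j ∧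
      ∃ w ∈ intLattice, dist (s j) (s i + w) < 2 * r by
    obtain ⟨i, j, hi, hj, hij, w, hw, hd⟩ := h
    rw [Finset.mem_Icc] at hi hj
    rcases lt_or_gt_of_ne hij with h | h
    · exact ⟨i, j, hi.1, h, hj.2, w, hw, hd⟩
    · refine ⟨j, i, hj.1, h, hi.2, -w, intLattice.neg_mem hw, ?_⟩
      rw [dist_comm, ← dist_add_right _ _ w, neg_add_cancel_right]
      exact hd
  by_contra! hcon
  let S : Set R2 := ⋃ i ∈ Finset.Icc 1 q, ball (s i) r
  have hS : MeasurableSet S := Finset.measurableSet_biUnion _ fun i _ => measurableSet_ball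
  have hvol : volume S = q * (ENNReal.ofReal r ^ 2 * ENNReal.ofReal Real.pi) := by
    rw [measure_biUnion_finset]
    · simp [EuclideanSpace.volume_ball_fin_two]
    · intro i hi j hj hij
      refine ball_disjoint_ball ?_
      have := hcon i j hi hj hij 0 intLattice.zero_mem
      rw [add_zero, dist_comm] at this
      linarith
    · intro i _
      exact measurableSet_ball
  have hlt : volume (fdom 0) < volume S := by
    rw [fdom_zero, vol_fund, hvol, ← ENNReal.ofReal_pow hr0.le, ← ENNReal.ofReal_mul (by positivity),
      ← ENNReal.ofReal_natCast, ← ENNReal.ofReal_mul (by positivity), ← ENNReal.ofReal_one]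
    exact (ENNReal.ofReal_lt_ofReal_iff (by linarith)).2 hq
  obtain ⟨a, b, hab, hnd⟩ := exists_pair_mem_lattice_not_disjoint_vadd (fdom_fund 0)
    hS.nullMeasurableSet hlt
  obtain ⟨x, hxa, hxb⟩ := Set.not_disjoint_iff.1 hnd
  obtain ⟨y, hy, rfl⟩ := hxa
  obtain ⟨z, hz, hzy⟩ := hxb
  have hzy' : (b : R2) + z = a + y := hzy
  simp only [S, mem_iUnion, mem_ball] at hy hz
  obtain ⟨i, hi, hyi⟩ := hy
  obtain ⟨j, hj, hzj⟩ := hz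
  have hd : dist (s j) (s i + ((a:R2) - b)) < 2 * r := by
    have h1 := dist_triangle (s j) z (s i + ((a:R2) - b))
    have h2 : dist z (s i + ((a:R2) - b)) = dist y (s i) := by
      rw [show z = y + ((a:R2) - b) by
        rw [eq_sub_of_add_eq' hzy']; abel, dist_add_right]
    rw [dist_comm (s j) z, h2] at h1
    linarith
  have hw : (a:R2) - b ∈ intLattice := intLattice.sub_mem a.2 b.2
  by_cases hij : i = j
  · subst hij
    rw [dist_self_add_right] at hd
    have := lat_norm_ge hw (fun h => hab (Subtype.ext (sub_eq_zero.1 h)))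
    linarith
  · exact absurd hd (not_lt.2 (hcon i j hi hj hij _ hw))

lemma ext_bound {F : R2 ≃ₜ R2} (hF : Good F) {δ : ℝ} (hδ : 0 < δ)
    (hs : UpperStable Homeo0Leb F δ) {v : R2} (hv : v ∈ Set.extremePoints ℝ (rotSet F))
    {p₁ p₂ q : ℤ} (hq : 1 ≤ q) (hg : Int.gcd p₁ (Int.gcd p₂ q) = 1)
    (h0 : v 0 = (p₁ : ℝ) / (q : ℝ)) (h1 : v 1 = (p₂ : ℝ) / (q : ℝ)) :
    (q : ℝ) ≤ 4 / (Real.pi * δ ^ 2) := by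
  by_contra! hlt
  have hpi := Real.pi_pos
  rw [div_lt_iff₀ (by positivity)] at hlt
  rcases lt_or_ge 1 δ with hδ1 | hδ1
  · obtain ⟨l, hl, L, hL, ⟨x, hx⟩, hvL⟩ := ext_mem_PS hF hδ hs (sub_pos.2 hδ1) (by linarith) hv
    have hl0 : (0:ℝ) < l := by positivity
    have key : ∀ e ∈ intLattice, ‖e‖ ≤ 1 → (l:ℝ)⁻¹ • (L + e) ∈ rotSet F := by
      intro e he hn
      refine lemA hF hδ hs hl (intLattice.add_mem hL he)
        (Wk.change (by linarith : δ - 1 ≤ δ) hl hx ?_)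
      rw [← add_assoc, dist_self_add_right]
      linarith
    have hne : ‖latVec 1 0‖ ≤ 1 := (norm_le_two _).trans (by simp [latVec])
    have a1 := key _ (latVec_mem 1 0) hne
    have a2 := key _ (intLattice.neg_mem (latVec_mem 1 0)) (by rwa [norm_neg])
    have := hv.2 a1 a2 ⟨1 / 2, 1 / 2, by norm_num, by norm_num, by norm_num, by
      rw [hvL]; module⟩
    rw [hvL] at this
    have h2 := smul_right_injective R2 (inv_ne_zero hl0.ne') this
    have h3 : latVec 1 0 = 0 := by simpa using h2
    have h4 : latVec 1 0 0 = (0 : R2) 0 := by rw [h3]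
    simp [latVec] at h4
  · obtain ⟨Q, rfl⟩ : ∃ Q : ℕ, q = Q := ⟨q.toNat, by omega⟩
    have hcont : Tendsto (fun ε : ℝ => ((Q:ℤ):ℝ) * (((δ - ε) / 2) ^ 2 * Real.pi)) (𝓝[>] 0)
        (𝓝 (((Q:ℤ):ℝ) * (((δ - 0) / 2) ^ 2 * Real.pi))) := by
      refine Tendsto.mono_left ?_ nhdsWithin_le_nhds
      exact Continuous.tendsto (by fun_prop) 0
    have ev1 := hcont.eventually (lt_mem_nhds (a := 1) (by nlinarith))
    have ev2 : ∀ᶠ ε : ℝ in 𝓝[>] 0, ε < δ := nhdsWithin_le_nhds (gt_mem_nhds hδ)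
    have ev3 : ∀ᶠ ε : ℝ in 𝓝[>] 0, 0 < ε := eventually_mem_nhdsWithin
    obtain ⟨ε, hε1, hε2, hε3⟩ := (ev1.and (ev2.and ev3)).exists
    obtain ⟨l, hl, L, hL, ⟨x, hx⟩, hvL⟩ := ext_mem_PS hF hδ hs hε3 hε2.le hv
    have hQl : Q ≤ l := by
      have := dvd_period hq hg h0 h1 hl hL hvL
      exact Nat.le_of_dvd hl (by exact_mod_cast this)
    obtain ⟨s, s0, s1, s2⟩ := hx.seq
    obtain ⟨i, j, hi, hij, hj, w, hw, hd⟩ := pack (r := (δ - ε) / 2) (by linarith) (by linarith) s Q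
      (by exact_mod_cast hε1)
    obtain ⟨d, rfl⟩ : ∃ d, j = i + d := ⟨j - i, by omega⟩
    obtain ⟨e, rfl⟩ : ∃ e, l = i + d + e := ⟨l - (i + d), by omega⟩
    have w1 : Wk (Ch F ε) i (s 0) (s (0 + i)) := Wk.of_seq s2 (by omega)
    have w2 : Wk (Ch F ε) d (s i) (s (i + d)) := Wk.of_seq s2 (by omega)
    have w3 : Wk (Ch F ε) e (s (i + d)) (s (i + d + e)) := Wk.of_seq s2 (by omega)
    rw [zero_add, s0] at w1
    rw [s1] at w3
    have hd1 : 1 ≤ d := by omega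
    have c1 := lemA hF hδ hs hd1 hw (Wk.change hε2.le hd1 w2 (by linarith))
    have w4 : Wk (Ch F δ) i x (s (i + d) + -w) := Wk.change hε2.le hi w1 (by
      rw [dist_comm, ← dist_add_right _ _ w, neg_add_cancel_right]
      linarith)
    have w5 := w4.trans (Wk.add (Ch.equi hF.eqv δ) (intLattice.neg_mem hw)
      (w3.mono (Ch.mono_eps hε2.le)))
    have c2 := lemA hF hδ hs (l := i + e) (by omega) (intLattice.add_mem hL (intLattice.neg_mem hw))
      (by rw [← add_assoc]; exact w5)
    have hd0 : (0:ℝ) < d := by exact_mod_cast hd1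
    have hie : (0:ℝ) < (i:ℝ) + e := by
      have : (0:ℝ) < i := by exact_mod_cast hi
      positivity
    have := hv.2 c1 c2 ⟨(d:ℝ) / (i + d + e), ((i:ℝ) + e) / (i + d + e), by positivity, by positivity, by
      field_simp; ring, by
      rw [hvL, smul_smul, smul_smul]
      push_cast
      rw [show (d:ℝ) / (i + d + e) * (d:ℝ)⁻¹ = ((i:ℝ) + d + e)⁻¹ by field_simp,
        show ((i:ℝ) + e) / (i + d + e) * ((i:ℝ) + e)⁻¹ = ((i:ℝ) + d + e)⁻¹ by field_simp]
      module⟩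
    have h5 := dvd_period hq hg h0 h1 hd1 hw this.symm
    have h6 : Q ≤ d := Nat.le_of_dvd hd1 (by exact_mod_cast h5)
    omega

lemma core {F : R2 ≃ₜ R2} (hF : Good F) {δ : ℝ} (hδ : 0 < δ) (hs : UpperStable Homeo0Leb F δ) :
      (∀ v ∈ Set.extremePoints ℝ (rotSet F), IsRationalPoint v) ∧
      (∀ v ∈ Set.extremePoints ℝ (rotSet F), ∀ p₁ p₂ q : ℤ, 1 ≤ q →
        Int.gcd p₁ (Int.gcd p₂ q) = 1 →
        v 0 = (p₁ : ℝ) / (q : ℝ) → v 1 = (p₂ : ℝ) / (q : ℝ) →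
        (q : ℝ) ≤ 4 / (Real.pi * δ ^ 2)) ∧
      (Set.extremePoints ℝ (rotSet F)).Finite ∧
      (∃ V : Finset R2, (∀ v ∈ V, IsRationalPoint v) ∧
        rotSet F = convexHull ℝ (V : Set R2)) := by
  obtain ⟨Q, q1, q2, q3⟩ := rot_eq_hull hF hδ hs hδ le_rfl
  refine ⟨fun v hv => PS_rational (ext_mem_PS hF hδ hs hδ le_rfl hv), ?_, ?_, ?_⟩
  · intro v hv p₁ p₂ q hq hg h0 h1
    exact ext_bound hF hδ hs hv hq hg h0 h1
  · rw [q3]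
    exact q1.subset extremePoints_convexHull_subset
  · refine ⟨q1.toFinset, fun v hv => PS_rational (q2 (by simpa using hv)), ?_⟩
    rw [q3, Finite.coe_toFinset]

lemma lift_diff {f : T2 ≃ₜ T2} {F G : R2 ≃ₜ R2} (hF : IsLift f F) (hG : IsLift f G) :
    ∃ w ∈ intLattice, ∀ x, G x = F x + w := by
  have hmem : ∀ x, G x - F x ∈ intLattice := by
    intro x
    rw [← pr_eq_iff, hF.proj, hG.proj]
  have hlc : IsLocallyConstant fun x => G x - F x := by
    rw [IsLocallyConstant.iff_eventually_eq]
    intro x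
    have hc : Continuous fun x => G x - F x := G.continuous.sub F.continuous
    filter_upwards [(hc.tendsto x).eventually (Metric.ball_mem_nhds _ one_pos)] with y hy
    have hy' : dist (G y - F y) (G x - F x) < 1 := hy
    by_contra hne
    have := lat_norm_ge (intLattice.sub_mem (hmem y) (hmem x)) (sub_ne_zero.2 hne)
    rw [dist_eq_norm] at hy'
    linarith
  refine ⟨G 0 - F 0, hmem 0, fun x => ?_⟩
  have : G x - F x = G 0 - F 0 := hlc.apply_eq_of_preconnectedSpace x 0
  rw [← this]; abel

lemma rot_shift {F G : R2 ≃ₜ R2} (hF : Eqv F) {w : R2} (hw : w ∈ intLattice)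
    (h : ∀ x, G x = F x + w) {v : R2} (hv : v ∈ rotSet F) : v + w ∈ rotSet G := by
  obtain ⟨z, n, hn, hlim⟩ := hv
  refine ⟨z, n, hn, ?_⟩
  have hit : ∀ (k : ℕ) (x : R2), (⇑G)^[k] x = (⇑F)^[k] x + (k:ℝ) • w := by
    intro k x
    induction k with
    | zero => simp
    | succ k ih =>
      rw [Function.iterate_succ_apply', Function.iterate_succ_apply', ih, h,
        hF _ _ (nsmul_lat hw k)]
      push_cast; module
  refine (hlim.add_const w).congr' ?_
  filter_upwards [hn.eventually (eventually_ge_atTop 1)] with k hk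
  have hk0 : (n k:ℝ) ≠ 0 := by
    have : n k ≠ 0 := by omega
    exact_mod_cast this
  rw [hit, show (⇑F)^[n k] (z k) + (n k:ℝ) • w - z k
    = ((⇑F)^[n k] (z k) - z k) + (n k:ℝ) • w by abel, smul_add (n k:ℝ)⁻¹ ((⇑F)^[n k] (z k) - z k), smul_smul,
    inv_mul_cancel₀ hk0, one_smul]

lemma stable_shift {F F₀ : R2 ≃ₜ R2} (hF₀ : Eqv F₀) {w : R2} (hw : w ∈ intLattice)
    (h : ∀ x, F x = F₀ x + w) {δ : ℝ} (hs : UpperStable Homeo0Leb F₀ δ) :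
    UpperStable Homeo0Leb F δ := by
  intro g hg G hG hd v hv
  let G' : R2 ≃ₜ R2 := G.trans (Homeomorph.addRight (-w))
  have hG' : ∀ x, G' x = G x + -w := fun x => rfl
  have hnw := intLattice.neg_mem hw
  have hl : IsLift g G' := by
    refine ⟨fun x => ?_, fun x u hu => ?_⟩
    · rw [hG', pr_add_lat _ hnw, hG.proj]
    · rw [hG', hG', hG.equivariant _ _ hu]; abel
  have hd' : supDist F₀ G' < δ := by
    have : supDist F₀ G' = supDist F G := by
      unfold supDist
      congr 1
      funext x
      rw [h, hG', ← dist_add_right (F₀ x) _ w, neg_add_cancel_right]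
    rwa [this]
  have h1 := hs g hg G' hl hd' (rot_shift hG.equivariant hnw hG' hv)
  have h2 := rot_shift hF₀ hw h h1
  simpa using h2


/-- If the rotation set of `f ∈ Homeo_{0,λ}(T²)` is `δ`-upper-stable in
`Homeo_{0,λ}(T²)` for some `δ > 0`, then for any lift `F` every extremal point of
`ρ(F)` is rational, its reduced denominator `q` satisfies `q ≤ 4/(πδ²)`, there are
finitely many extremal points, and `ρ(F)` is the convex hull of a finite subset of
`ℚ²`. -/
theorem upper_stable_extreme_points_bound_leb (f : T2 ≃ₜ T2) (hf : f ∈ Homeo0Leb)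
    (δ : ℝ) (hδ : 0 < δ)
    (hstab : ∃ F₀ : R2 ≃ₜ R2, IsLift f F₀ ∧ UpperStable Homeo0Leb F₀ δ) :
    ∀ F : R2 ≃ₜ R2, IsLift f F →
      (∀ v ∈ Set.extremePoints ℝ (rotSet F), IsRationalPoint v) ∧
      (∀ v ∈ Set.extremePoints ℝ (rotSet F), ∀ p₁ p₂ q : ℤ, 1 ≤ q →
        Int.gcd p₁ (Int.gcd p₂ q) = 1 →
        v 0 = (p₁ : ℝ) / (q : ℝ) → v 1 = (p₂ : ℝ) / (q : ℝ) →
        (q : ℝ) ≤ 4 / (Real.pi * δ ^ 2)) ∧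
      (Set.extremePoints ℝ (rotSet F)).Finite ∧
      (∃ V : Finset R2, (∀ v ∈ V, IsRationalPoint v) ∧
        rotSet F = convexHull ℝ (V : Set R2)) := by
  obtain ⟨F₀, hF₀, hs⟩ := hstab
  intro F hF
  obtain ⟨w, hw, h⟩ := lift_diff hF₀ hF
  exact core ⟨f, hF, hf.2⟩ hδ (stable_shift hF₀.equivariant hw h hs)
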